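/- arXiv:1809.07848 — 3 statements merged into one kernel-verified Lean document; each statement's English description precedes it below -/
import Mathlib

section
/- Let Φ: ℝ → ℂ be infinitely differentiable with compact support contained in (0,∞), let c be a positive integer, let h be an integer with gcd(h,c)=1, and let h̄ be any integer with h·h̄ ≡ 1 (mod c). Then for every σ > 0, ∑_{n=1}^∞ (τ(n)/n) e(n h̄ /c) Φ(n) = (1/c) ∫₀^∞ (log(x/c²) + 2γ) Φ(x) dx/x + (1/c) ∑_{r=1}^∞ τ(r) [ e(rh/c) Φ̌₊(r/c²) + e(−rh/c) Φ̌₋(r/c²) ], where Φ̌_±(x) := (1/(2πi)) ∫_{(σ)} G_1^±(s) Φ̃(−s) x^{−s} ds, γ is the Euler–Mascheroni constant, and the sum over r converges absolutely. -/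
open MeasureTheory Set

/-- `e(x) = exp(2πix)`. -/
noncomputable def e (x : ℂ) : ℂ := Complex.exp (2 * Real.pi * Complex.I * x)

/-- Mellin transform `Φ̃(s) = ∫₀^∞ Φ(x) x^{s−1} dx`. -/
noncomputable def mellinT (Φ : ℝ → ℂ) (s : ℂ) : ℂ :=
  ∫ x in Ioi (0 : ℝ), Φ x * (x : ℂ) ^ (s - 1)

/-- Vertical line integral `(1/(2πi)) ∫_{(σ)} f(s) ds = (1/(2π)) ∫_ℝ f(σ+iu) du`. -/
noncomputable def VI (σ : ℝ) (f : ℂ → ℂ) : ℂ :=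
  ((1 / (2 * Real.pi) : ℝ) : ℂ) * ∫ u : ℝ, f (σ + u * Complex.I)

/-- `G_1^+(s) = 2(2π)^{−2s} Γ(s)²`. -/
noncomputable def G1p (s : ℂ) : ℂ :=
  2 * ((2 * Real.pi : ℝ) : ℂ) ^ (-2 * s) * (Complex.Gamma s) ^ 2

/-- `G_1^−(s) = 2(2π)^{−2s} Γ(s)² cos(πs)`. -/
noncomputable def G1m (s : ℂ) : ℂ :=
  2 * ((2 * Real.pi : ℝ) : ℂ) ^ (-2 * s) * (Complex.Gamma s) ^ 2 * Complex.cos (Real.pi * s)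

/-- `Φ̌₊(x) = (1/(2πi)) ∫_{(σ)} G_1^+(s) Φ̃(−s) x^{−s} ds`. -/
noncomputable def checkPlus (Φ : ℝ → ℂ) (σ : ℝ) (x : ℝ) : ℂ :=
  VI σ (fun s => G1p s * mellinT Φ (-s) * (x : ℂ) ^ (-s))

/-- `Φ̌₋(x) = (1/(2πi)) ∫_{(σ)} G_1^−(s) Φ̃(−s) x^{−s} ds`. -/
noncomputable def checkMinus (Φ : ℝ → ℂ) (σ : ℝ) (x : ℝ) : ℂ :=
  VI σ (fun s => G1m s * mellinT Φ (-s) * (x : ℂ) ^ (-s))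

namespace Voronoi

open Complex in
lemma norm_Gamma_le {s : ℂ} (hs : 0 < s.re) : ‖Gamma s‖ ≤ Real.Gamma s.re := by
  rw [Gamma_eq_integral hs, Real.Gamma_eq_integral hs, GammaIntegral]
  refine (norm_integral_le_integral_norm _).trans_eq ?_
  refine setIntegral_congr_fun measurableSet_Ioi fun x (hx : 0 < x) => ?_
  simp [norm_cpow_eq_rpow_re_of_pos hx, norm_exp]

open Complex in
lemma norm_betaIntegral_le (u v : ℂ) :
    ‖betaIntegral u v‖ ≤ ‖betaIntegral u.re v.re‖ := by
  have hreal : betaIntegral u.re v.re =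
      ((∫ x in (0:ℝ)..1, x ^ (u.re - 1) * (1 - x) ^ (v.re - 1) : ℝ) : ℂ) := by
    rw [betaIntegral, ← intervalIntegral.integral_ofReal,
      intervalIntegral.integral_of_le zero_le_one, intervalIntegral.integral_of_le zero_le_one]
    refine setIntegral_congr_fun measurableSet_Ioc fun x hx => ?_
    rw [ofReal_mul, ofReal_cpow hx.1.le, ofReal_cpow (sub_nonneg.2 hx.2)]
    push_cast
    rfl
  rw [hreal, norm_real, betaIntegral]
  refine (intervalIntegral.norm_integral_le_integral_norm zero_le_one).trans ?_
  refine le_trans (le_of_eq ?_) (le_abs_self _)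
  rw [intervalIntegral.integral_of_le zero_le_one, intervalIntegral.integral_of_le zero_le_one,
    integral_Ioc_eq_integral_Ioo, integral_Ioc_eq_integral_Ioo]
  refine setIntegral_congr_fun measurableSet_Ioo fun x hx => ?_
  have h1 : (1 - (x : ℂ)) = ((1 - x : ℝ) : ℂ) := by push_cast; rfl
  rw [norm_mul, h1, norm_cpow_eq_rpow_re_of_pos hx.1,
    norm_cpow_eq_rpow_re_of_pos (sub_pos.2 hx.2)]
  simp

open Complex in
/-- The normalised quantity `|Γ(σ + it)| / Γ(σ)` increases with `σ`. -/
lemma norm_Gamma_mul_Gamma_le {s : ℂ} {d : ℝ} (hs : 0 < s.re) (hd : 0 < d) :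
    ‖Gamma s‖ * Real.Gamma (s.re + d) ≤ ‖Gamma (s + d)‖ * Real.Gamma s.re := by
  have h1 := Gamma_mul_Gamma_eq_betaIntegral (s := s) (t := (d : ℂ)) hs (by simpa using hd)
  have h2 := Gamma_mul_Gamma_eq_betaIntegral (s := (s.re : ℂ)) (t := (d : ℂ)) (by simpa using hs)
    (by simpa using hd)
  have hB := norm_betaIntegral_le s d
  rw [ofReal_re] at hB
  have hd0 : 0 < Real.Gamma d := Real.Gamma_pos_of_pos hd
  have hs0 : 0 < Real.Gamma s.re := Real.Gamma_pos_of_pos hs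
  have hsd : 0 < Real.Gamma (s.re + d) := Real.Gamma_pos_of_pos (by positivity)
  have n1 : ‖Gamma s‖ * Real.Gamma d = ‖Gamma (s + d)‖ * ‖betaIntegral s d‖ := by
    rw [← norm_mul, ← h1, norm_mul, Gamma_ofReal, norm_real, Real.norm_of_nonneg hd0.le]
  have n2 : Real.Gamma s.re * Real.Gamma d =
      Real.Gamma (s.re + d) * ‖betaIntegral s.re d‖ := by
    have := congrArg norm h2
    rw [norm_mul, norm_mul, ← ofReal_add, Gamma_ofReal, Gamma_ofReal, Gamma_ofReal, norm_real,
      norm_real, norm_real, Real.norm_of_nonneg hd0.le, Real.norm_of_nonneg hs0.le,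
      Real.norm_of_nonneg hsd.le] at this
    exact this
  refine le_of_mul_le_mul_right ?_ hd0
  calc ‖Gamma s‖ * Real.Gamma (s.re + d) * Real.Gamma d
      = ‖Gamma (s + d)‖ * (Real.Gamma (s.re + d) * ‖betaIntegral s d‖) := by
        rw [mul_right_comm, n1]; ring
    _ ≤ ‖Gamma (s + d)‖ * (Real.Gamma (s.re + d) * ‖betaIntegral s.re d‖) := by gcongr
    _ = ‖Gamma (s + d)‖ * Real.Gamma s.re * Real.Gamma d := by rw [← n2]; ring

open Complex in
lemma norm_Gamma_half_sq_mul_cosh (t : ℝ) :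
    ‖Gamma (1 / 2 + t * I)‖ ^ 2 * Real.cosh (Real.pi * t) = Real.pi := by
  have h := Gamma_mul_Gamma_one_sub (1 / 2 + t * I)
  have h1 : (1 : ℂ) - (1 / 2 + t * I) = (starRingEnd ℂ) (1 / 2 + t * I) := by
    simp only [map_add, map_mul, conj_ofReal, conj_I, map_div₀, map_one, map_ofNat]
    ring
  have h2 : Complex.sin (Real.pi * (1 / 2 + t * I)) = ((Real.cosh (Real.pi * t) : ℝ) : ℂ) := by
    rw [show (Real.pi * (1 / 2 + t * I) : ℂ) = Real.pi / 2 - (-(Real.pi * t : ℝ)) * I by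
      push_cast; ring, Complex.sin_pi_div_two_sub, Complex.cos_mul_I, Complex.cosh_neg,
      Complex.ofReal_cosh]
  rw [h1, Gamma_conj, h2, mul_conj, normSq_eq_norm_sq, ← ofReal_div] at h
  have h3 := ofReal_injective h
  rw [h3, div_mul_cancel₀ _ (Real.cosh_pos _).ne']

open Complex in
lemma norm_Gamma_add_half_le (N : ℕ) (t : ℝ) :
    ‖Gamma (N + 1 / 2 + t * I)‖ ≤ ((N + 1) * (1 + |t|)) ^ N * ‖Gamma (1 / 2 + t * I)‖ := by
  induction N with
  | zero => simp
  | succ n ih =>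
    have hne : (n + 1 / 2 + t * I : ℂ) ≠ 0 := by
      intro h
      have := congrArg re h
      simp at this
      have : (0 : ℝ) ≤ n := n.cast_nonneg
      linarith
    have hrw : ((n + 1 : ℕ) + 1 / 2 + t * I : ℂ) = (n + 1 / 2 + t * I) + 1 := by
      push_cast; ring
    rw [hrw, Gamma_add_one _ hne, norm_mul, pow_succ', mul_assoc]
    have hb : ‖(n + 1 / 2 + t * I : ℂ)‖ ≤ ((n + 1 : ℕ) + 1) * (1 + |t|) := by
      calc ‖(n + 1 / 2 + t * I : ℂ)‖ ≤ ‖(n + 1 / 2 : ℂ)‖ + ‖(t * I : ℂ)‖ := norm_add_le _ _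
        _ = (n + 1 / 2) + |t| := by
          rw [show (n + 1 / 2 : ℂ) = ((n + 1 / 2 : ℝ) : ℂ) by push_cast; rfl, norm_real,
            Real.norm_of_nonneg (by positivity)]
          simp
        _ ≤ _ := by
          have := abs_nonneg t
          have : (0 : ℝ) ≤ n := n.cast_nonneg
          push_cast
          nlinarith
    refine mul_le_mul hb (ih.trans ?_) (norm_nonneg _) (by positivity)
    gcongr
    linarith

open Complex in
lemma exists_norm_Gamma_sq_mul_cosh_le {a : ℝ} (ha : 0 < a) (b : ℝ) :
    ∃ (C : ℝ) (K : ℕ), 0 ≤ C ∧ ∀ s : ℂ, a ≤ s.re → s.re ≤ b →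
      ‖Gamma s‖ ^ 2 * Real.cosh (Real.pi * s.im) ≤ C * (1 + |s.im|) ^ K := by
  obtain ⟨N, hN⟩ := exists_nat_gt b
  have hcont : ContinuousOn Real.Gamma (Icc a b) := fun x hx =>
    (Real.differentiableAt_Gamma fun m => by
      have : (0 : ℝ) ≤ m := m.cast_nonneg
      linarith [hx.1]).continuousAt.continuousWithinAt
  obtain ⟨M, hM⟩ := isCompact_Icc.exists_bound_of_continuousOn hcont
  set G := Real.Gamma (N + 1 / 2) with hG
  have hGpos : 0 < G := Real.Gamma_pos_of_pos (by positivity)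
  refine ⟨(M / G * (N + 1) ^ N) ^ 2 * Real.pi, N * 2, by positivity, fun s hsa hsb => ?_⟩
  have hs : 0 < s.re := ha.trans_le hsa
  have h1 := norm_Gamma_mul_Gamma_le (s := s) (d := N + 1 / 2 - s.re) hs (by linarith)
  have e1 : s.re + (N + 1 / 2 - s.re) = N + 1 / 2 := by ring
  have e2 : s + ((N + 1 / 2 - s.re : ℝ) : ℂ) = N + 1 / 2 + s.im * I := by
    apply Complex.ext <;> simp
  rw [e1, e2, ← hG] at h1
  have hM' : Real.Gamma s.re ≤ M := (le_abs_self _).trans (hM _ ⟨hsa, hsb⟩)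
  have h2 : ‖Gamma s‖ ≤ M / G * (((N + 1) * (1 + |s.im|)) ^ N * ‖Gamma (1 / 2 + s.im * I)‖) := by
    rw [div_mul_eq_mul_div, le_div_iff₀ hGpos]
    refine h1.trans ?_
    rw [mul_comm]
    have : 0 < Real.Gamma s.re := Real.Gamma_pos_of_pos hs
    exact mul_le_mul hM' (norm_Gamma_add_half_le _ _) (norm_nonneg _) (this.le.trans hM')
  calc ‖Gamma s‖ ^ 2 * Real.cosh (Real.pi * s.im)
      ≤ (M / G * (((N + 1) * (1 + |s.im|)) ^ N * ‖Gamma (1 / 2 + s.im * I)‖)) ^ 2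
          * Real.cosh (Real.pi * s.im) := by
        gcongr
    _ = (M / G * (N + 1) ^ N) ^ 2 * (1 + |s.im|) ^ (N * 2) *
          (‖Gamma (1 / 2 + s.im * I)‖ ^ 2 * Real.cosh (Real.pi * s.im)) := by
        rw [mul_pow (N + 1 : ℝ)]; ring
    _ = _ := by rw [norm_Gamma_half_sq_mul_cosh]; ring

open Complex in
lemma norm_cos_le_cosh (z : ℂ) : ‖Complex.cos z‖ ≤ Real.cosh z.im := by
  rw [Complex.cos, norm_div, Real.cosh_eq, RCLike.norm_ofNat]
  gcongr
  refine (norm_add_le _ _).trans_eq ?_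
  simp [norm_exp, add_comm]

open Complex in
lemma norm_sin_le_cosh (z : ℂ) : ‖Complex.sin z‖ ≤ Real.cosh z.im := by
  rw [Complex.sin, norm_div, norm_mul, norm_I, mul_one, Real.cosh_eq, RCLike.norm_ofNat]
  gcongr
  refine (norm_sub_le _ _).trans_eq ?_
  simp [norm_exp]

open Complex in
lemma exists_norm_G1_le {a : ℝ} (ha : 0 < a) (b : ℝ) :
    ∃ (C : ℝ) (K : ℕ), 0 ≤ C ∧ ∀ s : ℂ, a ≤ s.re → s.re ≤ b →
      ‖G1p s‖ ≤ C * (1 + |s.im|) ^ K ∧ ‖G1m s‖ ≤ C * (1 + |s.im|) ^ K := by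
  obtain ⟨C, K, hC, h⟩ := exists_norm_Gamma_sq_mul_cosh_le ha b
  refine ⟨2 * C, K, by positivity, fun s hsa hsb => ?_⟩
  have h1 : ‖((2 * Real.pi : ℝ) : ℂ) ^ (-2 * s)‖ ≤ 1 := by
    rw [norm_cpow_eq_rpow_re_of_pos (by positivity)]
    refine Real.rpow_le_one_of_one_le_of_nonpos (by nlinarith [Real.pi_gt_three]) ?_
    simp
    linarith
  have h2 := h s hsa hsb
  have hg : ‖Gamma s‖ ^ 2 ≤ C * (1 + |s.im|) ^ K :=
    le_trans (le_mul_of_one_le_right (by positivity) (Real.one_le_cosh _)) h2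
  have hbase : ‖2 * ((2 * Real.pi : ℝ) : ℂ) ^ (-2 * s) * (Gamma s) ^ 2‖
      ≤ 2 * ‖Gamma s‖ ^ 2 := by
    rw [norm_mul, norm_mul, norm_pow, RCLike.norm_ofNat]
    have := norm_nonneg (((2 * Real.pi : ℝ) : ℂ) ^ (-2 * s))
    gcongr
    linarith
  constructor
  · rw [G1p]
    linarith
  · rw [G1m, norm_mul]
    have hc := norm_cos_le_cosh (Real.pi * s)
    rw [show (Real.pi * s : ℂ).im = Real.pi * s.im by simp] at hc
    calc _ ≤ (2 * ‖Gamma s‖ ^ 2) * Real.cosh (Real.pi * s.im) := by gcongr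
      _ ≤ _ := by linarith

/-- At most exponential growth in vertical strips, away from the real axis. -/
def ExpGrowth (f : ℂ → ℂ) : Prop :=
  ∀ a b : ℝ, ∃ C A : ℝ, 0 ≤ C ∧ 0 ≤ A ∧ ∀ z : ℂ, a ≤ z.re → z.re ≤ b → 1 ≤ |z.im| →
    ‖f z‖ ≤ C * Real.exp (A * |z.im|)

namespace ExpGrowth

variable {f g : ℂ → ℂ}

lemma of_bounded (h : ∀ a b : ℝ, ∃ C : ℝ, ∀ z : ℂ, a ≤ z.re → z.re ≤ b → 1 ≤ |z.im| → ‖f z‖ ≤ C) :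
    ExpGrowth f := fun a b => by
  obtain ⟨C, hC⟩ := h a b
  refine ⟨max C 0, 0, le_max_right _ _, le_rfl, fun z h1 h2 h3 => ?_⟩
  simpa using Or.inl (hC z h1 h2 h3)

lemma mul (hf : ExpGrowth f) (hg : ExpGrowth g) : ExpGrowth fun z => f z * g z := fun a b => by
  obtain ⟨C, A, hC, hA, h⟩ := hf a b
  obtain ⟨C', A', hC', hA', h'⟩ := hg a b
  refine ⟨C * C', A + A', by positivity, by positivity, fun z h1 h2 h3 => ?_⟩
  rw [norm_mul, add_mul, Real.exp_add, mul_mul_mul_comm]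
  exact mul_le_mul (h z h1 h2 h3) (h' z h1 h2 h3) (norm_nonneg _) (by positivity)

lemma add (hf : ExpGrowth f) (hg : ExpGrowth g) : ExpGrowth fun z => f z + g z := fun a b => by
  obtain ⟨C, A, hC, hA, h⟩ := hf a b
  obtain ⟨C', A', hC', hA', h'⟩ := hg a b
  refine ⟨C + C', max A A', by positivity, by positivity, fun z h1 h2 h3 => ?_⟩
  refine (norm_add_le _ _).trans ?_
  rw [add_mul]
  refine add_le_add ((h z h1 h2 h3).trans ?_) ((h' z h1 h2 h3).trans ?_)
  · gcongr
    exact le_max_left _ _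
  · gcongr
    exact le_max_right _ _

lemma congr (hf : ExpGrowth f) (h : ∀ z : ℂ, 1 ≤ |z.im| → g z = f z) : ExpGrowth g := fun a b => by
  obtain ⟨C, A, hC, hA, hb⟩ := hf a b
  exact ⟨C, A, hC, hA, fun z h1 h2 h3 => by rw [h z h3]; exact hb z h1 h2 h3⟩

lemma const (c : ℂ) : ExpGrowth fun _ => c := of_bounded fun _ _ => ⟨‖c‖, fun _ _ _ _ => le_rfl⟩

lemma sum {ι : Type*} (s : Finset ι) {F : ι → ℂ → ℂ} (h : ∀ i ∈ s, ExpGrowth (F i)) :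
    ExpGrowth fun z => ∑ i ∈ s, F i z := by
  classical
  induction s using Finset.induction_on with
  | empty => simpa using const 0
  | insert i s hi ih =>
    simp_rw [Finset.sum_insert hi]
    exact (h i (Finset.mem_insert_self _ _)).add
      (ih fun j hj => h j (Finset.mem_insert_of_mem hj))

lemma cpow {x : ℝ} (hx : 0 < x) (k : ℝ) : ExpGrowth fun z => (x : ℂ) ^ (k * z) := by
  refine of_bounded fun a b => ?_
  have hc : ContinuousOn (fun σ : ℝ => x ^ (k * σ)) (Icc a b) := by
    refine Continuous.continuousOn ?_
    exact Continuous.rpow continuous_const (by fun_prop) fun _ => Or.inl hx.ne'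
  obtain ⟨M, hM⟩ := isCompact_Icc.exists_bound_of_continuousOn hc
  refine ⟨M, fun z h1 h2 _ => ?_⟩
  have := hM z.re ⟨h1, h2⟩
  rw [Complex.norm_cpow_eq_rpow_re_of_pos hx]
  simpa using (le_abs_self _).trans this

lemma id : ExpGrowth fun z => z := fun a b => by
  refine ⟨max |a| |b| + 1, 1, by positivity, by positivity, fun z h1 h2 h3 => ?_⟩
  have h4 : |z.re| ≤ max |a| |b| := abs_le_max_abs_abs h1 h2
  have h5 := Real.add_one_le_exp (|z.im|)
  have h6 := Complex.norm_le_abs_re_add_abs_im z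
  have h7 : 0 ≤ max |a| |b| := (abs_nonneg a).trans (le_max_left _ _)
  rw [one_mul]
  nlinarith

lemma add_one (hf : ExpGrowth f) : ExpGrowth fun z => f (1 + z) := fun a b => by
  obtain ⟨C, A, hC, hA, h⟩ := hf (1 + a) (1 + b)
  refine ⟨C, A, hC, hA, fun z h1 h2 h3 => ?_⟩
  simpa using h (1 + z) (by simpa using h1) (by simpa using h2) (by simpa using h3)

end ExpGrowth

lemma mellin_bounded_of_convergent {f : ℝ → ℂ} (hf : ∀ s, MellinConvergent f s) (a b : ℝ) :
    ∃ C : ℝ, ∀ s : ℂ, a ≤ s.re → s.re ≤ b → ‖mellin f s‖ ≤ C := by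
  have ha := (hf a).norm
  have hb := (hf b).norm
  refine ⟨∫ t in Ioi (0:ℝ), (‖(t : ℂ) ^ ((a : ℂ) - 1) • f t‖ + ‖(t : ℂ) ^ ((b : ℂ) - 1) • f t‖),
    fun s h1 h2 => ?_⟩
  refine (norm_integral_le_integral_norm _).trans ?_
  refine setIntegral_mono_on (hf s).norm (ha.add hb) measurableSet_Ioi fun t (ht : 0 < t) => ?_
  rw [norm_smul, norm_smul, norm_smul, ← add_mul]
  refine mul_le_mul_of_nonneg_right ?_ (norm_nonneg _)
  simp only [Complex.norm_cpow_eq_rpow_re_of_pos ht, Complex.sub_re, Complex.ofReal_re,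
    Complex.one_re]
  rcases le_total 1 t with h | h
  · have := Real.rpow_le_rpow_of_exponent_le h (sub_le_sub_right h2 1)
    have := Real.rpow_nonneg ht.le (a - 1)
    linarith
  · have := Real.rpow_le_rpow_of_exponent_ge ht h (sub_le_sub_right h1 1)
    have := Real.rpow_nonneg ht.le (b - 1)
    linarith

lemma norm_Gamma_le_two_pow (n : ℕ) {w : ℂ} (hw : 1 / 2 ≤ |w.im|) :
    ‖Complex.Gamma w‖ ≤ 2 ^ n * ‖Complex.Gamma (w + n)‖ := by
  induction n with
  | zero => simp
  | succ n ih =>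
    have h1 : 1 / 2 ≤ ‖w + n‖ := by
      refine le_trans ?_ (Complex.abs_im_le_norm _)
      simpa using hw
    have hne : w + n ≠ 0 := norm_pos_iff.1 (by linarith)
    refine ih.trans ?_
    rw [Nat.cast_succ, ← add_assoc, Complex.Gamma_add_one _ hne, norm_mul, pow_succ, mul_assoc]
    gcongr
    have := norm_nonneg (Complex.Gamma (w + n))
    nlinarith

lemma exists_norm_inv_Gamma_le (a b : ℝ) : ∃ C : ℝ, 0 ≤ C ∧ ∀ z : ℂ, a ≤ z.re → z.re ≤ b →
    1 / 2 ≤ |z.im| → ‖(Complex.Gamma z)⁻¹‖ ≤ C * Real.exp (Real.pi * |z.im|) := by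
  obtain ⟨n, hn⟩ := exists_nat_gt b
  have hcont : ContinuousOn Real.Gamma (Icc (1 - b + n) (1 - a + n)) := fun x hx =>
    (Real.differentiableAt_Gamma fun m => by
      have : (0 : ℝ) ≤ m := m.cast_nonneg
      linarith [hx.1]).continuousAt.continuousWithinAt
  obtain ⟨M, hM⟩ := isCompact_Icc.exists_bound_of_continuousOn hcont
  refine ⟨2 ^ n * |M| / Real.pi, by positivity, fun z h1 h2 h3 => ?_⟩
  have hz : z.im ≠ 0 := by
    intro h
    rw [h] at h3
    norm_num at h3
  have hG : Complex.Gamma (1 - z) ≠ 0 := Complex.Gamma_ne_zero fun m hm => by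
    have := congrArg Complex.im hm
    simp at this
    exact hz this
  have hGz : Complex.Gamma z ≠ 0 := Complex.Gamma_ne_zero fun m hm => by
    have := congrArg Complex.im hm
    simp at this
    exact hz this
  have hrefl := Complex.Gamma_mul_Gamma_one_sub z
  have hinv : (Complex.Gamma z)⁻¹ = Complex.sin (Real.pi * z) * Complex.Gamma (1 - z) / Real.pi := by
    have hpi : (Real.pi : ℂ) ≠ 0 := by exact_mod_cast Real.pi_ne_zero
    have hsin : Complex.sin (Real.pi * z) ≠ 0 := fun h => by
      rw [h, div_zero] at hrefl
      exact mul_ne_zero hGz hG hrefl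
    rw [eq_div_iff hsin] at hrefl
    field_simp
    linear_combination -hrefl
  have hs : ‖Complex.sin (Real.pi * z)‖ ≤ Real.exp (Real.pi * |z.im|) := by
    refine (norm_sin_le_cosh _).trans ?_
    rw [show (Real.pi * z : ℂ).im = Real.pi * z.im by simp, ← Real.cosh_abs, abs_mul,
      abs_of_pos Real.pi_pos, Real.cosh_eq]
    have : Real.exp (-(Real.pi * |z.im|)) ≤ Real.exp (Real.pi * |z.im|) := by
      apply Real.exp_le_exp.2
      have : 0 ≤ Real.pi * |z.im| := by positivity
      linarith
    linarith
  have hg : ‖Complex.Gamma (1 - z)‖ ≤ 2 ^ n * |M| := by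
    refine (norm_Gamma_le_two_pow n (by simpa using h3)).trans ?_
    gcongr
    have hre : (1 - z + n).re = 1 - z.re + n := by simp
    refine (norm_Gamma_le (by rw [hre]; linarith)).trans ?_
    rw [hre]
    exact (le_abs_self _).trans ((hM _ ⟨by linarith, by linarith⟩).trans (le_abs_self _))
  rw [hinv, norm_div, norm_mul, Complex.norm_real, Real.norm_of_nonneg Real.pi_pos.le,
    div_mul_eq_mul_div, mul_comm (2 ^ n * |M|)]
  gcongr

lemma expGrowth_inv_Gammaℝ : ExpGrowth fun z => (Complex.Gammaℝ z)⁻¹ := by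
  have h1 : ExpGrowth fun z => (Complex.Gamma (z / 2))⁻¹ := fun a b => by
    obtain ⟨C, hC, h⟩ := exists_norm_inv_Gamma_le (a / 2) (b / 2)
    refine ⟨C, Real.pi / 2, hC, by positivity, fun z h1 h2 h3 => ?_⟩
    have hre : (z / 2).re = z.re / 2 := by simp
    have him : (z / 2).im = z.im / 2 := by simp
    have := h (z / 2) (by rw [hre]; linarith) (by rw [hre]; linarith)
      (by rw [him, abs_div, abs_two]; linarith)
    rw [him, abs_div, abs_two] at this
    convert this using 3
    ring
  refine ((ExpGrowth.cpow Real.pi_pos (1 / 2)).mul h1).congr fun z _ => ?_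
  rw [Complex.Gammaℝ_def, mul_inv, ← Complex.cpow_neg]
  congr 2
  push_cast
  ring

lemma expGrowth_hurwitzZeta (x : UnitAddCircle) : ExpGrowth (HurwitzZeta.hurwitzZeta x) := by
  have hΛ (P : WeakFEPair ℂ) (a b : ℝ) : ∃ C : ℝ, ∀ s : ℂ, a ≤ s.re → s.re ≤ b →
      ‖P.Λ₀ s‖ ≤ C :=
    mellin_bounded_of_convergent (f := P.f_modif)
      (fun s => (P.isStrongFEPair_toStrongFEPair.hasMellin s).1) a b
  have hodd : ExpGrowth (HurwitzZeta.completedHurwitzZetaOdd x) := by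
    refine ExpGrowth.of_bounded fun a b => ?_
    obtain ⟨C, hC⟩ := mellin_bounded_of_convergent (f := (HurwitzZeta.hurwitzOddFEPair x).f)
      (fun s => ((HurwitzZeta.isStrong_hurwitzOddFEPair x).hasMellin s).1) ((a + 1) / 2)
      ((b + 1) / 2)
    refine ⟨C / 2, fun z h1 h2 _ => ?_⟩
    have hre : ((z + 1) / 2).re = (z.re + 1) / 2 := by simp
    rw [HurwitzZeta.completedHurwitzZetaOdd, (HurwitzZeta.isStrong_hurwitzOddFEPair x).Λ_eq,
      norm_div, RCLike.norm_ofNat]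
    gcongr
    exact hC _ (by rw [hre]; linarith) (by rw [hre]; linarith)
  have heven₀ : ExpGrowth (HurwitzZeta.completedHurwitzZetaEven₀ x) := by
    refine ExpGrowth.of_bounded fun a b => ?_
    obtain ⟨C, hC⟩ := hΛ (HurwitzZeta.hurwitzEvenFEPair x) (a / 2) (b / 2)
    refine ⟨C / 2, fun z h1 h2 _ => ?_⟩
    have hre : (z / 2).re = z.re / 2 := by simp
    rw [HurwitzZeta.completedHurwitzZetaEven₀, norm_div, RCLike.norm_ofNat]
    gcongr
    exact hC _ (by rw [hre]; linarith) (by rw [hre]; linarith)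
  have hinv : ExpGrowth fun z => z⁻¹ := ExpGrowth.of_bounded fun a b => ⟨1, fun z _ _ h3 => by
    rw [norm_inv]
    exact inv_le_one_of_one_le₀ (h3.trans (Complex.abs_im_le_norm z))⟩
  have hinv' : ExpGrowth fun z => (1 - z)⁻¹ := ExpGrowth.of_bounded fun a b => ⟨1, fun z _ _ h3 => by
    rw [norm_inv]
    refine inv_le_one_of_one_le₀ (le_trans ?_ (Complex.abs_im_le_norm _))
    simpa using h3⟩
  have hev : ExpGrowth (HurwitzZeta.completedHurwitzZetaEven x) := by
    refine (heven₀.add (((ExpGrowth.const (-(if x = 0 then 1 else 0))).mul hinv).add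
      ((ExpGrowth.const (-1)).mul hinv'))).congr fun z _ => ?_
    rw [HurwitzZeta.completedHurwitzZetaEven_eq]
    ring
  refine ((hev.mul expGrowth_inv_Gammaℝ).add
    (hodd.mul expGrowth_inv_Gammaℝ.add_one)).congr fun z hz => ?_
  have hz0 : z ≠ 0 := by
    rintro rfl
    simp at hz
    linarith
  rw [HurwitzZeta.hurwitzZeta, HurwitzZeta.hurwitzZetaEven_def_of_ne_or_ne (Or.inr hz0),
    HurwitzZeta.hurwitzZetaOdd, div_eq_mul_inv, div_eq_mul_inv, add_comm z 1]

open Complex Filter Topology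

lemma line_continuous (σ : ℝ) : Continuous fun u : ℝ => (σ + u * I : ℂ) := by fun_prop

lemma line_re (σ u : ℝ) : (σ + u * I : ℂ).re = σ := by simp

lemma line_im (σ u : ℝ) : (σ + u * I : ℂ).im = u := by simp

/-- Decay like `|Im s|⁻²` in the strip `a ≤ Re s ≤ b`. -/
def StripDecay (a b : ℝ) (H : ℂ → ℂ) : Prop :=
  ContinuousOn H (re ⁻¹' Icc a b) ∧
    ∃ C : ℝ, ∀ s : ℂ, a ≤ s.re → s.re ≤ b → 1 ≤ |s.im| → ‖H s‖ ≤ C / s.im ^ 2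

lemma StripDecay.bound {a b : ℝ} {H : ℂ → ℂ} (h : StripDecay a b H) :
    ∃ C : ℝ, 0 ≤ C ∧ ∀ s : ℂ, a ≤ s.re → s.re ≤ b → ‖H s‖ ≤ C * (1 + s.im ^ 2)⁻¹ := by
  obtain ⟨hc, C, hC⟩ := h
  have hcpt : IsCompact (Icc a b ×ℂ Icc (-1) 1) := isCompact_Icc.reProdIm isCompact_Icc
  obtain ⟨M, hM⟩ := hcpt.exists_bound_of_continuousOn (hc.mono fun s hs => hs.1)
  refine ⟨2 * (|C| + |M|), by positivity, fun s h1 h2 => ?_⟩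
  rw [← div_eq_mul_inv, le_div_iff₀ (by positivity)]
  have hCn := abs_nonneg C
  have hMn := abs_nonneg M
  rcases le_total 1 |s.im| with h3 | h3
  · have h4 := hC s h1 h2 h3
    have h5 : 1 ≤ s.im ^ 2 := by rw [← sq_abs]; nlinarith
    rw [le_div_iff₀ (by linarith)] at h4
    have := le_abs_self C
    have := norm_nonneg (H s)
    nlinarith
  · have h4 := hM s ⟨⟨h1, h2⟩, abs_le.1 h3⟩
    have h5 : s.im ^ 2 ≤ 1 := by rw [← sq_abs]; nlinarith [abs_nonneg s.im]
    have := le_abs_self M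
    have := norm_nonneg (H s)
    nlinarith

lemma StripDecay.integrable {a b : ℝ} {H : ℂ → ℂ} (h : StripDecay a b H) {σ : ℝ}
    (ha : a ≤ σ) (hb : σ ≤ b) : Integrable fun u : ℝ => H (σ + u * I) := by
  obtain ⟨C, -, hC⟩ := h.bound
  refine (integrable_inv_one_add_sq.const_mul C).mono' ?_ (.of_forall fun u => ?_)
  · refine Continuous.aestronglyMeasurable ?_
    exact h.1.comp_continuous (line_continuous σ) fun u => by simp [ha, hb]
  · simpa using hC (σ + u * I) (by simpa) (by simpa)

lemma VI_add {σ : ℝ} {f g : ℂ → ℂ} (hf : Integrable fun u : ℝ => f (σ + u * I))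
    (hg : Integrable fun u : ℝ => g (σ + u * I)) :
    VI σ (fun s => f s + g s) = VI σ f + VI σ g := by
  simp only [VI]
  rw [integral_add hf hg, mul_add]

lemma VI_const_mul (σ : ℝ) (c : ℂ) (f : ℂ → ℂ) : VI σ (fun s => c * f s) = c * VI σ f := by
  simp only [VI]
  rw [integral_const_mul]
  ring

lemma VI_congr {σ : ℝ} {f g : ℂ → ℂ} (h : ∀ s : ℂ, s.re = σ → f s = g s) : VI σ f = VI σ g := by
  simp only [VI]
  congr 2
  ext u
  exact h _ (line_re _ _)

lemma VI_neg (σ : ℝ) (f : ℂ → ℂ) : VI (-σ) f = VI σ (fun s => f (-s)) := by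
  simp only [VI]
  congr 1
  rw [← integral_neg_eq_self]
  congr 1
  ext u
  congr 1
  push_cast
  ring

/-- Moving a line of integration across a region of holomorphy. -/
lemma VI_shift {a b : ℝ} (hab : a ≤ b) {H : ℂ → ℂ} (hd : DifferentiableOn ℂ H (re ⁻¹' Icc a b))
    (hH : StripDecay a b H) : VI a H = VI b H := by
  obtain ⟨C, hC0, hC⟩ := hH.bound
  have hrect (T : ℝ) : ((∫ x in a..b, H (x + (-T : ℝ) * I)) - ∫ x in a..b, H (x + T * I)) +
      I * (∫ y in (-T)..T, H (b + y * I)) - I * (∫ y in (-T)..T, H (a + y * I)) = 0 := by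
    have := integral_boundary_rect_eq_zero_of_differentiableOn H (a + (-T : ℝ) * I) (b + T * I)
      (hd.mono fun s hs => by
        have := hs.1
        simp only [line_re, uIcc_of_le hab] at this
        exact this)
    simpa only [line_re, line_im, smul_eq_mul] using this
  have hhor (f : ℝ → ℝ) (hf : ∀ T, f T ^ 2 = T ^ 2) :
      Tendsto (fun T : ℝ => ∫ x in a..b, H (x + f T * I)) atTop (𝓝 0) := by
    refine squeeze_zero_norm (a := fun T => C * (1 + T ^ 2)⁻¹ * |b - a|) (fun T => ?_) ?_
    · refine intervalIntegral.norm_integral_le_of_norm_le_const fun x hx => ?_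
      rw [uIoc_of_le hab] at hx
      simpa [hf] using hC (x + f T * I) (by simpa using hx.1.le) (by simpa using hx.2)
    · have h1 : Tendsto (fun T : ℝ => (1 + T ^ 2)⁻¹) atTop (𝓝 0) :=
        (tendsto_atTop_add_const_left _ _ (tendsto_pow_atTop two_ne_zero)).inv_tendsto_atTop
      simpa using (h1.const_mul C).mul_const |b - a|
  have hver (σ : ℝ) (h1 : a ≤ σ) (h2 : σ ≤ b) :
      Tendsto (fun T : ℝ => ∫ y in (-T)..T, H (σ + y * I)) atTop (𝓝 (∫ y : ℝ, H (σ + y * I))) :=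
    intervalIntegral_tendsto_integral (hH.integrable h1 h2) tendsto_neg_atTop_atBot tendsto_id
  have hlim := (((hhor (fun T => -T) (by simp)).sub (hhor (fun T => T) (by simp))).add
    ((hver b hab le_rfl).const_mul I)).sub ((hver a le_rfl hab).const_mul I)
  have h0 := tendsto_nhds_unique hlim (tendsto_const_nhds.congr fun T => (hrect T).symm)
  have h1 : (∫ y : ℝ, H (b + y * I)) = ∫ y : ℝ, H (a + y * I) := by
    refine mul_left_cancel₀ I_ne_zero ?_
    linear_combination h0
  rw [VI, VI, h1]

lemma integral_two_mul_div_add_sq {c : ℝ} (hc : 0 < c) :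
    ∫ u : ℝ, (2 * c / (u ^ 2 + c ^ 2) : ℝ) = 2 * Real.pi := by
  have h := Measure.integral_comp_mul_left (fun u : ℝ => (1 + u ^ 2)⁻¹) c⁻¹
  rw [integral_univ_inv_one_add_sq, inv_inv, abs_of_pos hc, smul_eq_mul] at h
  have : (fun u : ℝ => (2 * c / (u ^ 2 + c ^ 2) : ℝ)) =
      fun u => 2 / c * (1 + (c⁻¹ * u) ^ 2)⁻¹ := by
    ext u
    field_simp
    ring
  rw [this, integral_const_mul, h]
  field_simp

lemma VI_eq_of_eq_two_mul_div {c σ : ℝ} (hc : 0 < c) {f : ℂ → ℂ} {ε : ℂ}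
    (h : ∀ u : ℝ, f (σ + u * I) = ε * ((2 * c / (u ^ 2 + c ^ 2) : ℝ) : ℂ)) : VI σ f = ε := by
  rw [VI, funext h, integral_const_mul, integral_complex_ofReal, integral_two_mul_div_add_sq hc]
  have : (Real.pi : ℂ) ≠ 0 := by exact_mod_cast Real.pi_ne_zero
  push_cast
  field_simp

lemma stripDecay_sub_inv {a b p q : ℝ} (hc : ContinuousOn (fun s : ℂ => (s - p)⁻¹ - (s - q)⁻¹)
    (re ⁻¹' Icc a b)) : StripDecay a b fun s : ℂ => (s - p)⁻¹ - (s - q)⁻¹ := by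
  refine ⟨hc, |p - q|, fun s _ _ h3 => ?_⟩
  have him : 0 < |s.im| := by linarith
  have hp : |s.im| ≤ ‖s - p‖ := by simpa using abs_im_le_norm (s - p)
  have hq : |s.im| ≤ ‖s - q‖ := by simpa using abs_im_le_norm (s - q)
  have hp0 : s - p ≠ 0 := norm_pos_iff.1 (him.trans_le hp)
  have hq0 : s - q ≠ 0 := norm_pos_iff.1 (him.trans_le hq)
  change ‖(s - (p : ℂ))⁻¹ - (s - (q : ℂ))⁻¹‖ ≤ _
  rw [inv_sub_inv hp0 hq0, norm_div, norm_mul, ← sq_abs, sq]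
  have : ‖s - q - (s - p)‖ = |p - q| := by
    rw [show s - q - (s - p) = ((p - q : ℝ) : ℂ) by push_cast; ring, norm_real, Real.norm_eq_abs]
  rw [this]
  gcongr

lemma line_sub_ne_zero {σ p u : ℝ} (h : σ ≠ p) : (σ + u * I - p : ℂ) ≠ 0 := fun h0 => by
  have := congrArg re h0
  simp at this
  exact h (by linarith)

lemma stripContinuous_sub_inv {a b p : ℝ} (hp : p ∉ Icc a b) :
    DifferentiableOn ℂ (fun s : ℂ => (s - p)⁻¹) (re ⁻¹' Icc a b) := fun s hs => by
  have : s - p ≠ 0 := fun h => by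
    have := congrArg re h
    simp at this
    exact hp (by rw [show p = s.re by linarith]; exact hs)
  exact DifferentiableAt.differentiableWithinAt (by fun_prop (disch := assumption))

/-- The reference function `1/s - 1/(s - 2b)`, with a simple pole at `0`. -/
lemma VI_ref {b : ℝ} (hb : 0 < b) :
    VI b (fun s => (s - (0 : ℝ))⁻¹ - (s - (2 * b : ℝ))⁻¹) = 1 ∧
    VI (-b) (fun s => (s - (0 : ℝ))⁻¹ - (s - (2 * b : ℝ))⁻¹) = 0 := by
  have hsq (c u : ℝ) (hc : 0 < c) : ((u : ℂ) ^ 2 + c ^ 2) ≠ 0 := by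
    have : u ^ 2 + c ^ 2 ≠ 0 := by positivity
    exact_mod_cast this
  have key (c : ℝ) (hc : 0 < c) (u : ℝ) : (c + u * I : ℂ)⁻¹ - (-c + u * I)⁻¹ =
      1 * ((2 * c / (u ^ 2 + c ^ 2) : ℝ) : ℂ) := by
    have h1 : (c + u * I : ℂ) ≠ 0 := by simpa using line_sub_ne_zero (u := u) (p := 0) hc.ne'
    have h2 : (-c + u * I : ℂ) ≠ 0 := by
      simpa using line_sub_ne_zero (σ := -c) (u := u) (p := 0) (by linarith)
    have h3 := hsq c u hc
    push_cast
    rw [inv_sub_inv h1 h2, one_mul, div_eq_div_iff (mul_ne_zero h1 h2) h3]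
    linear_combination (-2 * c * u ^ 2) * I_sq
  have e1 : VI b (fun s => (s - (0 : ℝ))⁻¹ - (s - (2 * b : ℝ))⁻¹) = 1 := by
    refine VI_eq_of_eq_two_mul_div hb fun u => ?_
    rw [← key b hb u]
    push_cast
    ring
  refine ⟨e1, ?_⟩
  have e2 : VI (-b) (fun s => (s - (0 : ℝ))⁻¹ - (s - (-(2 * b) : ℝ))⁻¹) = -1 := by
    refine VI_eq_of_eq_two_mul_div hb fun u => ?_
    rw [neg_one_mul, ← one_mul (((2 * b / (u ^ 2 + b ^ 2) : ℝ) : ℂ)), ← key b hb u]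
    push_cast
    ring
  have hnot1 : (2 * b) ∉ Icc (-b) b := fun h => by linarith [h.2]
  have hnot2 : -(2 * b) ∉ Icc (-b) b := fun h => by linarith [h.1]
  have hdiff : DifferentiableOn ℂ (fun s : ℂ => (s - (-(2 * b) : ℝ))⁻¹ - (s - (2 * b : ℝ))⁻¹)
      (re ⁻¹' Icc (-b) b) := (stripContinuous_sub_inv hnot2).sub (stripContinuous_sub_inv hnot1)
  have hdec := stripDecay_sub_inv hdiff.continuousOn
  have e3 : VI (-b) (fun s => (s - (-(2 * b) : ℝ))⁻¹ - (s - (2 * b : ℝ))⁻¹) = 1 := by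
    have hsub : Icc (-b) 0 ⊆ Icc (-b) b := Icc_subset_Icc_right hb.le
    have hdiff' := hdiff.mono (preimage_mono (f := re) hsub)
    rw [VI_shift (b := 0) (by linarith) hdiff' (stripDecay_sub_inv hdiff'.continuousOn)]
    refine VI_eq_of_eq_two_mul_div (c := 2 * b) (by linarith) fun u => ?_
    rw [← key (2 * b) (by linarith) u]
    push_cast
    ring
  have hnb0 : (0 : ℝ) ∉ Icc (-b) (-b) := fun h => by linarith [h.2]
  have hnb2 : (-(2 * b) : ℝ) ∉ Icc (-b) (-b) := fun h => by linarith [h.1]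
  have hi1 : Integrable fun u : ℝ => (fun s : ℂ => (s - (0 : ℝ))⁻¹ - (s - (-(2 * b) : ℝ))⁻¹)
      (((-b : ℝ) : ℂ) + u * I) :=
    (stripDecay_sub_inv (((stripContinuous_sub_inv hnb0).sub
      (stripContinuous_sub_inv hnb2)).continuousOn)).integrable le_rfl le_rfl
  have hi2 := hdec.integrable (σ := -b) le_rfl (by linarith)
  have hadd := VI_add (f := fun s : ℂ => (s - (0 : ℝ))⁻¹ - (s - (-(2 * b) : ℝ))⁻¹)
    (g := fun s : ℂ => (s - (-(2 * b) : ℝ))⁻¹ - (s - (2 * b : ℝ))⁻¹) hi1 hi2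
  rw [e2, e3, neg_add_cancel] at hadd
  rw [← hadd]
  exact VI_congr fun s _ => by ring

/-- Moving the line of integration of `g(s)/s²` across the double pole at the origin. -/
lemma VI_shift_double_pole {g : ℂ → ℂ} (hg : Differentiable ℂ g) {b : ℝ} (hb : 0 < b) {C : ℝ}
    (hbd : ∀ s : ℂ, -b ≤ s.re → s.re ≤ b → ‖g s‖ ≤ C) :
    VI b (fun s => g s / s ^ 2) = deriv g 0 + VI (-b) (fun s => g s / s ^ 2) := by
  set K : ℂ → ℂ := dslope (dslope g 0) 0 with hK
  have hKd : Differentiable ℂ K := by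
    have h1 : DifferentiableOn ℂ (dslope g 0) univ :=
      (differentiableOn_dslope univ_mem).2 hg.differentiableOn
    exact differentiableOn_univ.1 ((differentiableOn_dslope univ_mem).2 h1)
  have hKe (s : ℂ) (hs : s ≠ 0) : K s = g s / s ^ 2 - g 0 / s ^ 2 - deriv g 0 / s := by
    rw [hK, dslope_of_ne _ hs, slope_def_field, dslope_same, dslope_of_ne _ hs, slope_def_field]
    simp only [sub_zero]
    field_simp
  set R : ℂ → ℂ := fun s => (s - (0 : ℝ))⁻¹ - (s - (2 * b : ℝ))⁻¹ with hR
  set H : ℂ → ℂ := fun s => K s + deriv g 0 * (s - (2 * b : ℝ))⁻¹ with hHdef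
  have hnot1 : (2 * b) ∉ Icc (-b) b := fun h => by linarith [h.2]
  have hHd : DifferentiableOn ℂ H (re ⁻¹' Icc (-b) b) :=
    hKd.differentiableOn.add ((stripContinuous_sub_inv hnot1).const_mul _)
  have hdecomp (s : ℂ) (hs : s ≠ 0) :
      g s / s ^ 2 = H s + (g 0 * (s ^ 2)⁻¹ + deriv g 0 * R s) := by
    simp only [hHdef, hR, hKe s hs, ofReal_zero, sub_zero]
    ring
  have hHdec : StripDecay (-b) b H := by
    refine ⟨hHd.continuousOn, C + ‖g 0‖ + ‖deriv g 0‖ * (2 * b), fun s h1 h2 h3 => ?_⟩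
    have him : 0 < |s.im| := by linarith
    have hs0 : s ≠ 0 := norm_pos_iff.1 (him.trans_le (abs_im_le_norm s))
    have hp : |s.im| ≤ ‖s - (2 * b : ℝ)‖ := by simpa using abs_im_le_norm (s - (2 * b : ℝ))
    have hp0 : s - (2 * b : ℝ) ≠ 0 := norm_pos_iff.1 (him.trans_le hp)
    have hHe : H s = g s / s ^ 2 - g 0 / s ^ 2 + deriv g 0 * (2 * b) / (s * (s - (2 * b : ℝ))) := by
      simp only [hHdef, hKe s hs0]
      push_cast at hp0 ⊢
      field_simp
      ring
    have hsq : s.im ^ 2 ≤ ‖s ^ 2‖ := by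
      rw [norm_pow, ← sq_abs]
      exact pow_le_pow_left₀ him.le (abs_im_le_norm s) 2
    have hsq' : s.im ^ 2 ≤ ‖s * (s - (2 * b : ℝ))‖ := by
      rw [norm_mul, ← sq_abs, sq]
      exact mul_le_mul (abs_im_le_norm s) hp him.le (norm_nonneg _)
    have hpos : 0 < s.im ^ 2 := by rw [← sq_abs]; positivity
    have hC0 : 0 ≤ C := (norm_nonneg _).trans (hbd s h1 h2)
    rw [hHe, add_div, add_div]
    refine (norm_add_le _ _).trans (add_le_add ((norm_sub_le _ _).trans (add_le_add ?_ ?_)) ?_)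
    · rw [norm_div]
      exact div_le_div₀ hC0 (hbd s h1 h2) hpos hsq
    · rw [norm_div]
      exact div_le_div_of_nonneg_left (norm_nonneg _) hpos hsq
    · rw [norm_div, norm_mul, show ‖(2 * b : ℂ)‖ = 2 * b by
        rw [norm_mul, norm_real, Real.norm_of_nonneg hb.le, RCLike.norm_ofNat]]
      exact div_le_div_of_nonneg_left (by positivity) hpos hsq'
  have hline (σ : ℝ) (hσ : σ ≠ 0) (h1 : -b ≤ σ) (h2 : σ ≤ b) :
      VI σ (fun s => g s / s ^ 2) = VI σ H + (g 0 * VI σ (fun s => (s ^ 2)⁻¹)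
        + deriv g 0 * VI σ R) := by
    have h0 : (0 : ℝ) ∉ Icc σ σ := fun h => hσ (le_antisymm h.1 h.2)
    have h2b : (2 * b : ℝ) ∉ Icc σ σ := fun h => by linarith [h.2]
    have hcinv := (stripContinuous_sub_inv h0).continuousOn
    have hiR : Integrable fun u : ℝ => R (σ + u * I) :=
      (stripDecay_sub_inv ((hcinv.sub
        (stripContinuous_sub_inv h2b).continuousOn))).integrable le_rfl le_rfl
    have hi2 : Integrable fun u : ℝ => ((σ + u * I : ℂ) ^ 2)⁻¹ := by
      have : StripDecay σ σ (fun s : ℂ => (s ^ 2)⁻¹) := by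
        refine ⟨(hcinv.pow 2).congr fun s _ => by simp, 1, fun s _ _ h3 => ?_⟩
        have hpos : 0 < s.im ^ 2 := by rw [← sq_abs]; positivity
        have hsq : s.im ^ 2 ≤ ‖s ^ 2‖ := by
          rw [norm_pow, ← sq_abs]
          exact pow_le_pow_left₀ (abs_nonneg _) (abs_im_le_norm s) 2
        rw [norm_inv, one_div]
        exact inv_anti₀ hpos hsq
      exact this.integrable le_rfl le_rfl
    rw [← VI_const_mul, ← VI_const_mul,
      ← VI_add (f := fun s => g 0 * (s ^ 2)⁻¹) (g := fun s => deriv g 0 * R s)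
        (hi2.const_mul _) (hiR.const_mul _),
      ← VI_add (f := H) (g := fun s => g 0 * (s ^ 2)⁻¹ + deriv g 0 * R s)
        (hHdec.integrable h1 h2) ((hi2.const_mul _).add (hiR.const_mul _))]
    refine VI_congr fun s hs => hdecomp s ?_
    rintro rfl
    exact hσ (by simpa using hs.symm)
  have href := VI_ref hb
  have hH := VI_shift (by linarith) hHd hHdec
  have hsymm : VI (-b) (fun s => (s ^ 2)⁻¹) = VI b (fun s => (s ^ 2)⁻¹) := by
    rw [VI_neg]
    exact VI_congr fun s _ => by rw [neg_sq]
  rw [hline b hb.ne' (by linarith) le_rfl, hline (-b) (by linarith) le_rfl (by linarith), href.1,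
    href.2, hH, hsymm]
  ring

/-- Smooth functions with compact support in `(0, ∞)`. -/
structure IsTest (Φ : ℝ → ℂ) : Prop where
  smooth : ContDiff ℝ (⊤ : ℕ∞) Φ
  compact : HasCompactSupport Φ
  pos : tsupport Φ ⊆ Ioi 0

namespace IsTest

variable {Φ : ℝ → ℂ}

lemma eq_zero (hΦ : IsTest Φ) {t : ℝ} (ht : t ≤ 0) : Φ t = 0 :=
  image_eq_zero_of_notMem_tsupport fun h => (not_lt.2 ht) (hΦ.pos h)

lemma deriv_eq_zero (hΦ : IsTest Φ) {t : ℝ} (ht : t ≤ 0) : deriv Φ t = 0 :=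
  image_eq_zero_of_notMem_tsupport fun h =>
    (not_lt.2 ht) (hΦ.pos (closure_minimal (support_deriv_subset) (isClosed_tsupport _) h))

lemma hasCompactSupport_mul (hΦ : IsTest Φ) (f : ℝ → ℂ) :
    HasCompactSupport fun t => f t * Φ t := hΦ.compact.mul_left

lemma continuous_mul (hΦ : IsTest Φ) {f : ℝ → ℂ} (hf : ContinuousOn f (Ioi 0)) :
    Continuous fun t => f t * Φ t := by
  refine continuous_of_tsupport fun t ht => ?_
  have h1 : t ∈ Ioi (0 : ℝ) := hΦ.pos (closure_mono (Function.support_mul_subset_right _ _) ht)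
  exact (hf.continuousAt (Ioi_mem_nhds h1)).mul hΦ.smooth.continuous.continuousAt

lemma integrable_mul (hΦ : IsTest Φ) {f : ℝ → ℂ} (hf : ContinuousOn f (Ioi 0)) :
    Integrable fun t => f t * Φ t :=
  (hΦ.continuous_mul hf).integrable_of_hasCompactSupport (hΦ.hasCompactSupport_mul f)

lemma continuousOn_cpow (s : ℂ) : ContinuousOn (fun t : ℝ => (t : ℂ) ^ s) (Ioi 0) :=
  fun t ht => (continuousAt_ofReal_cpow_const t s (Or.inr (ne_of_gt ht))).continuousWithinAt

lemma mellinConvergent (hΦ : IsTest Φ) (s : ℂ) : MellinConvergent Φ s :=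
  (hΦ.integrable_mul (continuousOn_cpow (s - 1))).integrableOn

/-- The Euler operator `x d/dx` preserves test functions. -/
lemma euler (hΦ : IsTest Φ) : IsTest fun t => (t : ℂ) * deriv Φ t where
  smooth := by
    refine ContDiff.mul ofRealCLM.contDiff ?_
    exact (contDiff_infty_iff_deriv.1 hΦ.smooth).2
  compact := hΦ.compact.deriv.mul_left
  pos := by
    refine Subset.trans ?_ hΦ.pos
    refine closure_minimal ?_ (isClosed_tsupport _)
    exact (Function.support_mul_subset_right _ _).trans support_deriv_subset

lemma mellin_euler (hΦ : IsTest Φ) (s : ℂ) :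
    mellin (fun t => (t : ℂ) * deriv Φ t) s = -(s * mellin Φ s) := by
  have hi0 : Integrable fun t : ℝ => (t : ℂ) ^ s * Φ t := hΦ.integrable_mul (continuousOn_cpow s)
  have hi1 : Integrable fun t : ℝ => (t : ℂ) ^ (s - 1) * Φ t :=
    hΦ.integrable_mul (continuousOn_cpow _)
  have hi2 : Integrable fun t : ℝ => (t : ℂ) ^ (s - 1) * ((t : ℂ) * deriv Φ t) :=
    hΦ.euler.integrable_mul (continuousOn_cpow _)
  have hder (t : ℝ) : HasDerivAt (fun t : ℝ => (t : ℂ) ^ s * Φ t)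
      (s * ((t : ℂ) ^ (s - 1) * Φ t) + (t : ℂ) ^ (s - 1) * ((t : ℂ) * deriv Φ t)) t := by
    rcases le_or_gt t 0 with ht | ht
    · have hz : (fun t : ℝ => (t : ℂ) ^ s * Φ t) =ᶠ[𝓝 t] fun _ => 0 := by
        have : (tsupport Φ)ᶜ ∈ 𝓝 t := (isClosed_tsupport Φ).isOpen_compl.mem_nhds
          fun h => (not_lt.2 ht) (hΦ.pos h)
        filter_upwards [this] with u hu
        rw [image_eq_zero_of_notMem_tsupport hu, mul_zero]
      rw [hΦ.eq_zero ht, hΦ.deriv_eq_zero ht]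
      simpa using (hasDerivAt_const t (0 : ℂ)).congr_of_eventuallyEq hz
    · have h1 : HasDerivAt (fun t : ℝ => (t : ℂ) ^ s) (s * (t : ℂ) ^ (s - 1)) t := by
        have := (hasDerivAt_id (t : ℂ)).cpow_const (c := s) (Or.inl (by simpa using ht))
        simpa using this.comp_ofReal
      have h2 : HasDerivAt Φ (deriv Φ t) t :=
        (hΦ.smooth.differentiable (by simp)).differentiableAt.hasDerivAt
      have ht0 : (t : ℂ) ≠ 0 := by exact_mod_cast ht.ne'
      refine (h1.mul h2).congr_deriv ?_
      rw [cpow_sub _ _ ht0, cpow_one]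
      field_simp
  have h := integral_eq_zero_of_hasDerivAt_of_integrable hder ((hi1.const_mul s).add hi2) hi0
  rw [integral_add (hi1.const_mul s) hi2, integral_const_mul] at h
  simp only [mellin, smul_eq_mul]
  rw [setIntegral_eq_integral_of_forall_compl_eq_zero, setIntegral_eq_integral_of_forall_compl_eq_zero]
  · linear_combination h
  · intro t ht
    rw [hΦ.eq_zero (not_lt.1 ht), mul_zero]
  · intro t ht
    rw [hΦ.deriv_eq_zero (not_lt.1 ht), mul_zero, mul_zero]

/-- The Mellin transform of a test function decays rapidly in vertical strips. -/
lemma exists_norm_mellin_le (k : ℕ) (a b : ℝ) : ∀ {Φ : ℝ → ℂ}, IsTest Φ →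
    ∃ C, ∀ s : ℂ, a ≤ s.re → s.re ≤ b → ‖s‖ ^ k * ‖mellin Φ s‖ ≤ C := by
  induction k with
  | zero =>
    intro Φ hΦ
    simpa using mellin_bounded_of_convergent hΦ.mellinConvergent a b
  | succ k ih =>
    intro Φ hΦ
    obtain ⟨C, hC⟩ := ih hΦ.euler
    refine ⟨C, fun s h1 h2 => ?_⟩
    have := hC s h1 h2
    rwa [mellin_euler hΦ, norm_neg, norm_mul, ← mul_assoc, ← pow_succ] at this

lemma hasDerivAt_mellin (hΦ : IsTest Φ) (s : ℂ) :
    HasDerivAt (mellin Φ) (mellin (fun t => Real.log t • Φ t) s) s := by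
  refine (mellin_hasDerivAt_of_isBigO_rpow (a := s.re + 1) (b := s.re - 1) ?_ ?_ (by linarith) ?_
    (by linarith)).2
  · exact hΦ.smooth.continuous.locallyIntegrable.locallyIntegrableOn _
  · have : Φ =ᶠ[atTop] fun _ => 0 := by
      have := hΦ.compact.isCompact.isBounded.bddAbove
      obtain ⟨M, hM⟩ := this
      filter_upwards [eventually_gt_atTop M] with t ht
      exact image_eq_zero_of_notMem_tsupport fun h => (not_lt.2 (hM h)) ht
    exact this.trans_isBigO (Asymptotics.isBigO_zero _ _)
  · have : Φ =ᶠ[𝓝[>] 0] fun _ => 0 := by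
      have : (tsupport Φ)ᶜ ∈ 𝓝 (0 : ℝ) := (isClosed_tsupport Φ).isOpen_compl.mem_nhds
          fun h => lt_irrefl (0 : ℝ) (hΦ.pos h)
      filter_upwards [mem_nhdsWithin_of_mem_nhds this] with t ht
      exact image_eq_zero_of_notMem_tsupport ht
    exact this.trans_isBigO (Asymptotics.isBigO_zero _ _)

lemma differentiable_mellin (hΦ : IsTest Φ) : Differentiable ℂ (mellin Φ) :=
  fun s => (hΦ.hasDerivAt_mellin s).differentiableAt

lemma mellin_log_zero (Φ : ℝ → ℂ) : mellin (fun t => Real.log t • Φ t) 0 =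
    ∫ x in Ioi (0 : ℝ), (Real.log x : ℂ) * Φ x / x := by
  simp only [mellin]
  refine setIntegral_congr_fun measurableSet_Ioi fun t ht => ?_
  have ht0 : (t : ℂ) ≠ 0 := by exact_mod_cast (ne_of_gt ht)
  simp only [real_smul, smul_eq_mul, zero_sub, cpow_neg_one]
  field_simp

/-- `(1 + |Im s|)^k |F(s)|` is bounded in vertical strips. -/
lemma exists_norm_mellin_le' (hΦ : IsTest Φ) (k : ℕ) (a b : ℝ) :
    ∃ C, 0 ≤ C ∧ ∀ s : ℂ, a ≤ s.re → s.re ≤ b → (1 + |s.im|) ^ k * ‖mellin Φ s‖ ≤ C := by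
  obtain ⟨C, hC⟩ := exists_norm_mellin_le k a b hΦ
  obtain ⟨C', hC'⟩ := exists_norm_mellin_le 0 a b hΦ
  refine ⟨2 ^ k * (|C| + |C'|), by positivity, fun s h1 h2 => ?_⟩
  have e1 := (hC s h1 h2).trans (le_abs_self C)
  have e2 := (hC' s h1 h2).trans (le_abs_self C')
  rw [pow_zero, one_mul] at e2
  have key : (1 + |s.im|) ^ k ≤ 2 ^ k * (1 + ‖s‖ ^ k) := by
    rcases le_total 1 |s.im| with h | h
    · calc (1 + |s.im|) ^ k ≤ (2 * ‖s‖) ^ k := by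
            have := abs_im_le_norm s
            gcongr
            linarith
        _ ≤ 2 ^ k * (1 + ‖s‖ ^ k) := by
            rw [mul_pow]
            gcongr
            linarith
    · calc (1 + |s.im|) ^ k ≤ 2 ^ k := by gcongr; linarith
        _ ≤ 2 ^ k * (1 + ‖s‖ ^ k) := by
            have : 0 ≤ ‖s‖ ^ k := by positivity
            have : (0 : ℝ) < 2 ^ k := by positivity
            nlinarith
  calc (1 + |s.im|) ^ k * ‖mellin Φ s‖ ≤ 2 ^ k * (1 + ‖s‖ ^ k) * ‖mellin Φ s‖ := by gcongr
    _ = 2 ^ k * (‖s‖ ^ k * ‖mellin Φ s‖ + ‖mellin Φ s‖) := by ring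
    _ ≤ _ := by gcongr

end IsTest

lemma mellinT_eq (Φ : ℝ → ℂ) : mellinT Φ = mellin Φ := by
  ext s
  simp only [mellinT, mellin, smul_eq_mul]
  congr 1
  ext x
  ring

lemma IsTest.stripDecay_mellin {Φ : ℝ → ℂ} (hΦ : IsTest Φ) (a b : ℝ) :
    StripDecay a b (mellin Φ) := by
  obtain ⟨C, -, hC⟩ := hΦ.exists_norm_mellin_le' 2 a b
  refine ⟨hΦ.differentiable_mellin.continuous.continuousOn, C, fun s h1 h2 h3 => ?_⟩
  have hpos : 0 < s.im ^ 2 := by rw [← sq_abs]; positivity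
  rw [le_div_iff₀ hpos, mul_comm]
  refine le_trans ?_ (hC s h1 h2)
  rw [← sq_abs]
  gcongr
  linarith

lemma VI_mellin {Φ : ℝ → ℂ} (hΦ : IsTest Φ) (σ : ℝ) {x : ℝ} (hx : 0 < x) :
    VI σ (fun s => mellin Φ s * (x : ℂ) ^ (-s)) = Φ x := by
  have h := mellinInv_mellin_eq σ Φ hx (hΦ.mellinConvergent σ)
    ((hΦ.stripDecay_mellin σ σ).integrable le_rfl le_rfl)
    hΦ.smooth.continuous.continuousAt
  rw [← h, VI, mellinInv, real_smul]
  congr 2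
  ext u
  rw [smul_eq_mul, mul_comm]

open ZMod

section Estermann

variable {N : ℕ}

/-- The indicator function of a residue class. -/
noncomputable def delta (j : ZMod N) : ZMod N → ℂ := Pi.single j 1

lemma delta_apply (j k : ZMod N) : delta j k = if k = j then 1 else 0 := Pi.single_apply j 1 k

lemma delta_neg (j : ZMod N) : (fun k => delta j (-k)) = delta (-j) := by
  ext k
  simp [delta_apply, neg_eq_iff_eq_neg]

lemma mul_eq_zero_iff_of_mul_eq_one {a b : ZMod N} (hab : a * b = 1) (j : ZMod N) :
    a * j = 0 ↔ j = 0 :=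
  ⟨fun h => by linear_combination b * h - j * hab, fun h => by simp [h]⟩

variable [NeZero N]

/-- The additive character `k ↦ exp(2πi m k / N)`. -/
noncomputable def chi (m : ZMod N) : ZMod N → ℂ := fun k => stdAddChar (m * k)

lemma dft_delta (j : ZMod N) : 𝓕 (delta j) = chi (-j) := by
  ext k
  simp [dft_apply, delta_apply, chi]

lemma dft_chi (m : ZMod N) : 𝓕 (chi m) = fun k => (N : ℂ) * delta m k := by
  rw [show chi m = 𝓕 (delta (-m)) by rw [dft_delta, neg_neg], dft_dft]
  ext k
  simp [delta_apply, neg_eq_iff_eq_neg]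

lemma chi_neg (m : ZMod N) : (fun k => chi m (-k)) = chi (-m) := by
  ext k
  simp [chi]

lemma sum_chi (m : ZMod N) : ∑ k, chi m k = if m = 0 then (N : ℂ) else 0 := by
  have := AddChar.sum_mulShift m (isPrimitive_stdAddChar N)
  simp only [chi]
  simp_rw [mul_comm m]
  rw [this]
  split_ifs <;> simp [ZMod.card]

/-- The Estermann function `∑ τ(n) e(an/N) n^{-s}`. -/
noncomputable def estermann (a : ZMod N) (s : ℂ) : ℂ :=
  ∑ j, LFunction (delta j) s * LFunction (chi (a * j)) s

lemma LFunction_const_mul (c : ℂ) (f : ZMod N → ℂ) (s : ℂ) :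
    LFunction (fun k => c * f k) s = c * LFunction f s := by
  simp only [LFunction, mul_assoc, ← Finset.mul_sum]
  ring

lemma LFunction_sum {ι : Type*} (t : Finset ι) (f : ι → ZMod N → ℂ) (s : ℂ) :
    LFunction (fun k => ∑ i ∈ t, f i k) s = ∑ i ∈ t, LFunction (f i) s := by
  simp only [LFunction, Finset.sum_mul]
  rw [Finset.sum_comm, Finset.mul_sum]

lemma LSeriesHasSum_estermann (a : ZMod N) {s : ℂ} (hs : 1 < s.re) :
    LSeriesHasSum (fun n => (n.divisors.card : ℂ) * stdAddChar (a * (n : ZMod N))) s (estermann a s) := by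
  have h1 (f : ZMod N → ℂ) : LSeriesHasSum (fun n : ℕ => f n) s (LFunction f s) := by
    rw [LFunction_eq_LSeries f hs]
    exact (LSeriesSummable_of_one_lt_re f hs).LSeriesHasSum
  have h2 : LSeriesHasSum (fun n => ∑ j : ZMod N, LSeries.convolution (fun n : ℕ => delta j n)
      (fun n : ℕ => chi (a * j) n) n) s (estermann a s) := by
    have := hasSum_sum (s := (Finset.univ : Finset (ZMod N)))
      fun j _ => (h1 (delta j)).convolution (h1 (chi (a * j)))
    refine HasSum.congr_fun this fun n => ?_
    simp only [LSeries.term_def]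
    split_ifs <;> simp [Finset.sum_div]
  refine (LSeriesHasSum_congr _ _ ?_).1 h2
  intro n hn
  simp only [LSeries.convolution_def]
  have hcard : n.divisors.card = n.divisorsAntidiagonal.card := by
    rw [← Nat.map_div_right_divisors, Finset.card_map]
  rw [Finset.sum_comm, hcard, ← nsmul_eq_mul]
  refine Finset.sum_eq_card_nsmul fun p hp => ?_
  have hp' : ((p.1 : ZMod N) * p.2) = n := by
    rw [← Nat.cast_mul, (Nat.mem_divisorsAntidiagonal.1 hp).1]
  simp [delta_apply, chi, mul_assoc, hp']

lemma estermann_one_sub {a b : ZMod N} (hab : a * b = 1) {s : ℂ} (hs : 1 < s.re) :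
    estermann a (1 - s) = (N : ℂ)⁻¹ * (N : ℂ) ^ (2 * s) *
      (G1p s * estermann b s + G1m s * estermann (-b) s) := by
  have hs1 (n : ℕ) : s ≠ -n := by
    rintro rfl
    simp at hs
    have : (0 : ℝ) ≤ n := n.cast_nonneg
    linarith
  have hs2 : s ≠ 1 := by
    rintro rfl
    simp at hs
  have hre (f : ZMod N → ZMod N → ℂ) : ∑ j, f j (a * j) = ∑ k, f (b * k) k := by
    refine Fintype.sum_bijective (fun j => a * j) ?_ _ _ fun j => ?_
    · refine Function.bijective_iff_has_inverse.2 ⟨fun k => b * k, fun j => ?_, fun k => ?_⟩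
      · linear_combination j * hab
      · linear_combination k * hab
    · rw [← mul_assoc, mul_comm b a, hab, one_mul]
  have hd (j : ZMod N) := LFunction_one_sub (delta j) hs1 (Or.inr hs2)
  have hc (j : ZMod N) := LFunction_one_sub (chi (a * j)) hs1 (Or.inr hs2)
  simp only [dft_delta, delta_neg, neg_neg] at hd
  simp only [chi_neg, dft_chi, LFunction_const_mul] at hc
  have e1 : ∑ j : ZMod N, LFunction (chi (-j)) s * LFunction (delta (a * j)) s =
      estermann (-b) s := by
    rw [hre fun j k => LFunction (chi (-j)) s * LFunction (delta k) s, estermann]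
    exact Finset.sum_congr rfl fun k _ => by rw [neg_mul, mul_comm]
  have e2 : ∑ j : ZMod N, LFunction (chi j) s * LFunction (delta (a * j)) s =
      estermann b s := by
    rw [hre fun j k => LFunction (chi j) s * LFunction (delta k) s, estermann]
    exact Finset.sum_congr rfl fun k _ => by rw [mul_comm]
  have e3 : ∑ j : ZMod N, LFunction (chi (-j)) s * LFunction (delta (-(a * j))) s =
      estermann b s := by
    rw [← e2, ← Equiv.sum_comp (Equiv.neg (ZMod N))]
    simp
  have e4 : ∑ j : ZMod N, LFunction (chi j) s * LFunction (delta (-(a * j))) s =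
      estermann (-b) s := by
    rw [← e1, ← Equiv.sum_comp (Equiv.neg (ZMod N))]
    simp
  set E := cexp (Real.pi * I * s / 2) with hE
  set E' := cexp (-Real.pi * I * s / 2) with hE'
  have hEE : E * E' = 1 := by rw [hE, hE', ← Complex.exp_add]; simp; ring_nf; simp
  have hcos : E ^ 2 + E' ^ 2 = 2 * Complex.cos (Real.pi * s) := by
    rw [Complex.cos, hE, hE', ← Complex.exp_nat_mul, ← Complex.exp_nat_mul]
    push_cast
    ring_nf
  have hsum : estermann a (1 - s) = ((N : ℂ) ^ (s - 1) * (2 * Real.pi) ^ (-s) * Gamma s) ^ 2 * N *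
      (E ^ 2 * estermann (-b) s + E * E' * estermann b s + E * E' * estermann b s +
        E' ^ 2 * estermann (-b) s) := by
    nth_rewrite 1 [← e1]
    nth_rewrite 1 [← e3]
    rw [← e2, ← e4]
    simp only [Finset.mul_sum, ← Finset.sum_add_distrib, estermann]
    refine Finset.sum_congr rfl fun j _ => ?_
    rw [hd, hc]
    ring
  have hN : (N : ℂ) ≠ 0 := Nat.cast_ne_zero.2 (NeZero.ne N)
  have hpow1 : ((N : ℂ) ^ (s - 1)) ^ 2 * N = (N : ℂ)⁻¹ * (N : ℂ) ^ (2 * s) := by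
    rw [cpow_sub _ _ hN, cpow_one, two_mul, cpow_add _ _ hN]
    field_simp
  have hpow2 : ((2 * Real.pi : ℂ) ^ (-s)) ^ 2 = ((2 * Real.pi : ℝ) : ℂ) ^ (-2 * s) := by
    rw [← cpow_nat_mul]
    push_cast
    ring_nf
  rw [hsum, G1p, G1m, ← hpow1, ← hpow2]
  linear_combination (((N : ℂ) ^ (s - 1) * (2 * Real.pi) ^ (-s) * Gamma s) ^ 2 * N) *
    (2 * estermann b s * hEE + estermann (-b) s * hcos)

/-- The entire function `(s - 1) L(f, s)`. -/
noncomputable def entireL (f : ZMod N → ℂ) : ℂ → ℂ :=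
  Function.update (fun s => (s - 1) * LFunction f s) 1 (∑ j, f j / N)

lemma entireL_of_ne (f : ZMod N → ℂ) {s : ℂ} (hs : s ≠ 1) :
    entireL f s = (s - 1) * LFunction f s := Function.update_of_ne hs _ _

lemma entireL_one (f : ZMod N → ℂ) : entireL f 1 = ∑ j, f j / N := Function.update_self _ _ _

lemma differentiable_entireL (f : ZMod N → ℂ) : Differentiable ℂ (entireL f) := by
  rw [← differentiableOn_univ,
    ← differentiableOn_compl_singleton_and_continuousAt_iff (c := 1) univ_mem]
  constructor
  · intro s hs
    have hs1 : s ≠ 1 := hs.2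
    refine DifferentiableAt.differentiableWithinAt ?_
    have : entireL f =ᶠ[𝓝 s] fun s => (s - 1) * LFunction f s := by
      filter_upwards [isOpen_ne.mem_nhds hs1] with z hz using entireL_of_ne f hz
    rw [this.differentiableAt_iff]
    exact (by fun_prop : DifferentiableAt ℂ (fun s : ℂ => s - 1) s).mul
      (differentiableAt_LFunction f s (Or.inl hs1))
  · rw [entireL, continuousAt_update_same]
    exact LFunction_residue_one f

lemma entireL_const_mul (c : ℂ) (f : ZMod N → ℂ) (s : ℂ) :
    entireL (fun k => c * f k) s = c * entireL f s := by
  rcases eq_or_ne s 1 with rfl | hs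
  · simp only [entireL_one, Finset.mul_sum, mul_div_assoc]
  · rw [entireL_of_ne _ hs, entireL_of_ne _ hs, LFunction_const_mul]
    ring

lemma entireL_sum {ι : Type*} (t : Finset ι) (f : ι → ZMod N → ℂ) (s : ℂ) :
    entireL (fun k => ∑ i ∈ t, f i k) s = ∑ i ∈ t, entireL (f i) s := by
  rcases eq_or_ne s 1 with rfl | hs
  · simp only [entireL_one, Finset.sum_div]
    rw [Finset.sum_comm]
  · simp only [entireL_of_ne _ hs, LFunction_sum, Finset.mul_sum]

lemma expGrowth_entireL (f : ZMod N → ℂ) : ExpGrowth (entireL f) := by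
  have h1 : ExpGrowth fun s => (N : ℂ) ^ (((-1 : ℝ) : ℂ) * s) :=
    ExpGrowth.cpow (x := N) (by exact_mod_cast Nat.pos_of_ne_zero (NeZero.ne N)) (-1)
  have h2 := ExpGrowth.sum (Finset.univ : Finset (ZMod N)) fun j _ =>
    (ExpGrowth.const (f j)).mul (expGrowth_hurwitzZeta (toAddCircle j))
  refine ((ExpGrowth.id.add (ExpGrowth.const (-1))).mul (h1.mul h2)).congr fun z hz => ?_
  have : z ≠ 1 := by
    rintro rfl
    norm_num at hz
  rw [entireL_of_ne _ this, LFunction]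
  push_cast
  ring_nf

lemma hasDerivAt_entireL_delta_zero : HasDerivAt (entireL (delta (0 : ZMod N)))
    ((Real.eulerMascheroniConstant - Complex.log N) / N) 1 := by
  have hN : (N : ℂ) ≠ 0 := Nat.cast_ne_zero.2 (NeZero.ne N)
  have h1 : entireL (delta (0 : ZMod N)) 1 = 1 / N := by
    simp [entireL_one, delta_apply, ite_div]
  have hpow : HasDerivAt (fun s : ℂ => (N : ℂ) ^ (-s)) (-(Complex.log N / N)) 1 := by
    have := (hasDerivAt_neg (1 : ℂ)).const_cpow (c := (N : ℂ)) (Or.inl hN)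
    refine this.congr_deriv ?_
    rw [cpow_neg_one]
    field_simp
  rw [hasDerivAt_iff_tendsto_slope]
  have h2 := (((hpow.continuousAt.tendsto.mono_left nhdsWithin_le_nhds).mul
    tendsto_riemannZeta_sub_one_div)).add (hasDerivAt_iff_tendsto_slope.1 hpow)
  have e1 : ((N : ℂ) ^ (-(1 : ℂ)) * Real.eulerMascheroniConstant + -(Complex.log N / N)) =
      (Real.eulerMascheroniConstant - Complex.log N) / N := by
    rw [cpow_neg_one]
    field_simp
    ring
  rw [e1] at h2
  refine h2.congr' ?_
  filter_upwards [self_mem_nhdsWithin] with s hs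
  have hs1 : s ≠ 1 := hs
  have hs2 : s - 1 ≠ 0 := sub_ne_zero.2 hs1
  rw [slope_def_field, slope_def_field, h1, entireL_of_ne _ hs1, LFunction, cpow_neg_one]
  simp only [delta_apply, ite_mul, one_mul, zero_mul, Finset.sum_ite_eq', Finset.mem_univ, if_true,
    map_zero, HurwitzZeta.hurwitzZeta_zero]
  field_simp
  ring

/-- The entire function `s² D(1 + s)`, where `D` is the Estermann function. -/
noncomputable def entireEst (a : ZMod N) (s : ℂ) : ℂ :=
  ∑ j, entireL (delta j) (1 + s) * entireL (chi (a * j)) (1 + s)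

lemma entireEst_of_ne (a : ZMod N) {s : ℂ} (hs : s ≠ 0) :
    entireEst a s = s ^ 2 * estermann a (1 + s) := by
  have h1 : 1 + s ≠ 1 := by simpa using hs
  simp only [entireEst, estermann, entireL_of_ne _ h1, Finset.mul_sum]
  exact Finset.sum_congr rfl fun j _ => by ring

lemma differentiable_entireEst (a : ZMod N) : Differentiable ℂ (entireEst a) :=
  .fun_sum fun _ _ => ((differentiable_entireL _).comp (by fun_prop)).mul
    ((differentiable_entireL _).comp (by fun_prop))

lemma expGrowth_entireEst (a : ZMod N) : ExpGrowth (entireEst a) :=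
  ExpGrowth.sum _ fun _ _ => (expGrowth_entireL _).add_one.mul (expGrowth_entireL _).add_one

lemma entireL_delta_one (j : ZMod N) : entireL (delta j) 1 = (N : ℂ)⁻¹ := by
  simp [entireL_one, delta_apply, ite_div]

lemma entireL_chi_one (m : ZMod N) : entireL (chi m) 1 = if m = 0 then 1 else 0 := by
  have hN : (N : ℂ) ≠ 0 := Nat.cast_ne_zero.2 (NeZero.ne N)
  rw [entireL_one, ← Finset.sum_div, sum_chi]
  split_ifs <;> simp [hN]

lemma entireEst_zero {a b : ZMod N} (hab : a * b = 1) : entireEst a 0 = (N : ℂ)⁻¹ := by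
  simp [entireEst, entireL_delta_one, entireL_chi_one, mul_eq_zero_iff_of_mul_eq_one hab]

lemma deriv_entireEst_zero {a b : ZMod N} (hab : a * b = 1) :
    deriv (entireEst a) 0 = 2 * ((Real.eulerMascheroniConstant - Complex.log N) / N) := by
  have hN : (N : ℂ) ≠ 0 := Nat.cast_ne_zero.2 (NeZero.ne N)
  have hshift (f : ZMod N → ℂ) : HasDerivAt (fun s => entireL f (1 + s)) (deriv (entireL f) 1) 0 := by
    have := (differentiable_entireL f (1 + 0)).hasDerivAt.comp_const_add 1 0
    simpa using this
  have h := HasDerivAt.fun_sum (u := Finset.univ) fun (j : ZMod N) (_ : j ∈ Finset.univ) =>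
    (hshift (delta j)).mul (hshift (chi (a * j)))
  have hderiv := (h.congr_deriv rfl).deriv
  have hsum : ∑ j, deriv (entireL (chi (a * j))) 1 = N * deriv (entireL (delta (0 : ZMod N))) 1 := by
    have h1 : (fun s => ∑ j, entireL (chi (a * j)) s) =
        fun s => N * entireL (delta (0 : ZMod N)) s := by
      ext s
      rw [← entireL_sum, ← entireL_const_mul]
      congr 1
      ext k
      have := sum_chi (a * k)
      rw [delta_apply]
      simp only [chi] at this ⊢
      rw [mul_ite, mul_one, mul_zero]
      simp only [mul_eq_zero_iff_of_mul_eq_one hab] at this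
      rw [← this]
      exact Finset.sum_congr rfl fun j _ => by ring_nf
    rw [← deriv_const_mul _ (differentiable_entireL _ _), ← h1, deriv_fun_sum]
    exact fun j _ => differentiable_entireL _ _
  have h0 : deriv (entireEst a) 0 = _ := hderiv
  rw [h0]
  simp only [add_zero, entireL_delta_one, entireL_chi_one, mul_eq_zero_iff_of_mul_eq_one hab,
    Finset.sum_add_distrib, mul_ite, mul_one, mul_zero, Finset.sum_ite_eq', Finset.mem_univ,
    if_true, ← Finset.mul_sum, hsum, hasDerivAt_entireL_delta_zero.deriv]
  field_simp
  ring

end Estermann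

lemma differentiableAt_Gamma_of_re_pos {s : ℂ} (hs : 0 < s.re) : DifferentiableAt ℂ Gamma s :=
  differentiableAt_Gamma s fun m h => by
    have := congrArg re h
    simp only [neg_re, natCast_re] at this
    have : (0 : ℝ) ≤ m := m.cast_nonneg
    linarith

lemma differentiableAt_G1p {s : ℂ} (hs : 0 < s.re) : DifferentiableAt ℂ G1p s := by
  have h1 := differentiableAt_Gamma_of_re_pos hs
  have h2 : ((2 * Real.pi : ℝ) : ℂ) ≠ 0 := ofReal_ne_zero.2 (by positivity)
  unfold G1p
  exact ((DifferentiableAt.const_cpow (by fun_prop) (Or.inl h2)).const_mul 2).mul (h1.pow 2)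

lemma differentiableAt_G1m {s : ℂ} (hs : 0 < s.re) : DifferentiableAt ℂ G1m s :=
  (differentiableAt_G1p hs).mul (by fun_prop : DifferentiableAt ℂ (fun s => cos (Real.pi * s)) s)

lemma stripDecay_of_norm_le {Φ : ℝ → ℂ} (hΦ : IsTest Φ) {a b C : ℝ} {K : ℕ} (hC : 0 ≤ C)
    {G : ℂ → ℂ} (hG : ContinuousOn G (re ⁻¹' Icc a b))
    (hb : ∀ s : ℂ, a ≤ s.re → s.re ≤ b → ‖G s‖ ≤ C * (1 + |s.im|) ^ K) :
    StripDecay a b fun s => G s * mellin Φ (-s) := by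
  obtain ⟨C', -, hC'⟩ := hΦ.exists_norm_mellin_le' (K + 2) (-b) (-a)
  refine ⟨hG.mul (hΦ.differentiable_mellin.continuous.comp continuous_neg).continuousOn, C * C',
    fun s h1 h2 h3 => ?_⟩
  have h4 := hC' (-s) (by simpa using h2) (by simpa using h1)
  rw [neg_im, abs_neg] at h4
  have hpos : 0 < s.im ^ 2 := by rw [← sq_abs]; positivity
  rw [le_div_iff₀ hpos, norm_mul]
  calc ‖G s‖ * ‖mellin Φ (-s)‖ * s.im ^ 2
      ≤ C * (1 + |s.im|) ^ K * ‖mellin Φ (-s)‖ * (1 + |s.im|) ^ 2 := by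
        rw [← sq_abs s.im]
        gcongr
        · exact hb s h1 h2
        · linarith
    _ = C * ((1 + |s.im|) ^ (K + 2) * ‖mellin Φ (-s)‖) := by ring
    _ ≤ C * C' := by gcongr

lemma stripDecay_G1_mul_mellin {Φ : ℝ → ℂ} (hΦ : IsTest Φ) {a : ℝ} (ha : 0 < a) (b : ℝ) :
    (StripDecay a b fun s => G1p s * mellin Φ (-s)) ∧
      StripDecay a b fun s => G1m s * mellin Φ (-s) := by
  obtain ⟨C, K, hC, h⟩ := exists_norm_G1_le ha b
  exact ⟨stripDecay_of_norm_le hΦ hC (fun s hs =>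
      (differentiableAt_G1p (ha.trans_le hs.1)).continuousAt.continuousWithinAt)
      fun s h1 h2 => (h s h1 h2).1,
    stripDecay_of_norm_le hΦ hC (fun s hs =>
      (differentiableAt_G1m (ha.trans_le hs.1)).continuousAt.continuousWithinAt)
      fun s h1 h2 => (h s h1 h2).2⟩

lemma StripDecay.mul_cpow {a b x : ℝ} {H : ℂ → ℂ} (hH : StripDecay a b H) (hx : 0 < x) :
    StripDecay a b fun s => H s * (x : ℂ) ^ (-s) := by
  have hx0 : (x : ℂ) ≠ 0 := ofReal_ne_zero.2 hx.ne'
  obtain ⟨C, hC⟩ := hH.2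
  obtain ⟨M, hM⟩ := (isCompact_Icc (a := a) (b := b)).exists_bound_of_continuousOn
    (f := fun σ : ℝ => x ^ (-σ))
    (Continuous.rpow continuous_const (by fun_prop) fun _ => Or.inl hx.ne').continuousOn
  refine ⟨hH.1.mul (Continuous.const_cpow (by fun_prop) (Or.inl hx0)).continuousOn, C * M,
    fun s h1 h2 h3 => ?_⟩
  have h4 := hM s.re ⟨h1, h2⟩
  have h5 := hC s h1 h2 h3
  rw [Real.norm_of_nonneg (by positivity)] at h4
  rw [norm_mul, norm_cpow_eq_rpow_re_of_pos hx, neg_re, mul_div_right_comm]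
  exact mul_le_mul h5 h4 (by positivity) ((norm_nonneg _).trans h5)

lemma VI_G1_eq {Φ : ℝ → ℂ} (hΦ : IsTest Φ) {G : ℂ → ℂ}
    (hd : ∀ s : ℂ, 0 < s.re → DifferentiableAt ℂ G s)
    (hG : ∀ a b : ℝ, 0 < a → StripDecay a b fun s => G s * mellin Φ (-s)) {a b : ℝ} (ha : 0 < a)
    (hb : 0 < b) {x : ℝ} (hx : 0 < x) :
    VI a (fun s => G s * mellin Φ (-s) * (x : ℂ) ^ (-s)) =
      VI b (fun s => G s * mellin Φ (-s) * (x : ℂ) ^ (-s)) := by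
  wlog hab : a ≤ b
  · exact (this hΦ hd hG hb ha hx (le_of_not_ge hab)).symm
  have hx0 : (x : ℂ) ≠ 0 := ofReal_ne_zero.2 hx.ne'
  refine VI_shift hab (fun s hs => DifferentiableAt.differentiableWithinAt ?_)
    ((hG a b ha).mul_cpow hx)
  exact ((hd s (ha.trans_le hs.1)).mul
    ((hΦ.differentiable_mellin _).comp s differentiableAt_id.neg)).mul
    (DifferentiableAt.const_cpow (by fun_prop) (Or.inl hx0))

lemma checkPlus_eq {Φ : ℝ → ℂ} (hΦ : IsTest Φ) {a b x : ℝ} (ha : 0 < a) (hb : 0 < b)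
    (hx : 0 < x) : checkPlus Φ a x = checkPlus Φ b x := by
  simp only [checkPlus, mellinT_eq]
  exact VI_G1_eq hΦ (fun _ => differentiableAt_G1p)
    (fun a b ha => (stripDecay_G1_mul_mellin hΦ ha b).1) ha hb hx

lemma checkMinus_eq {Φ : ℝ → ℂ} (hΦ : IsTest Φ) {a b x : ℝ} (ha : 0 < a) (hb : 0 < b)
    (hx : 0 < x) : checkMinus Φ a x = checkMinus Φ b x := by
  simp only [checkMinus, mellinT_eq]
  exact VI_G1_eq hΦ (fun _ => differentiableAt_G1m)
    (fun a b ha => (stripDecay_G1_mul_mellin hΦ ha b).2) ha hb hx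

/-- Termwise integration of a Dirichlet series along a vertical line. -/
lemma hasSum_VI {ι : Type*} [Countable ι] {α : ι → ℂ} {x : ι → ℝ} (hx : ∀ i, 0 < x i) {σ : ℝ}
    {W D : ℂ → ℂ} (hW : Integrable fun u : ℝ => W (σ + u * I))
    (hD : ∀ s : ℂ, s.re = σ → HasSum (fun i => α i * (x i : ℂ) ^ (-s)) (D s)) :
    HasSum (fun i => α i * VI σ fun s => W s * (x i : ℂ) ^ (-s)) (VI σ fun s => W s * D s) := by
  have hnorm (i : ι) (u : ℝ) : ‖(x i : ℂ) ^ (-(σ + u * I : ℂ))‖ = x i ^ (-σ) := by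
    rw [norm_cpow_eq_rpow_re_of_pos (hx i), neg_re, line_re]
  have hmeas (i : ι) : Continuous fun u : ℝ => (x i : ℂ) ^ (-(σ + u * I : ℂ)) :=
    Continuous.const_cpow (by fun_prop) (Or.inl (ofReal_ne_zero.2 (hx i).ne'))
  have hint (i : ι) : Integrable fun u : ℝ =>
      α i * (W (σ + u * I) * (x i : ℂ) ^ (-(σ + u * I : ℂ))) := by
    refine Integrable.const_mul ?_ _
    exact hW.mul_bdd (c := x i ^ (-σ)) (hmeas i).aestronglyMeasurable
      (.of_forall fun u => (hnorm i u).le)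
  have hsum : Summable fun i => ∫ u : ℝ,
      ‖α i * (W (σ + u * I) * (x i : ℂ) ^ (-(σ + u * I : ℂ)))‖ := by
    have h1 := (hD σ (ofReal_re σ)).summable.norm.mul_right (∫ u : ℝ, ‖W (σ + u * I)‖)
    refine h1.congr fun i => ?_
    simp_rw [norm_mul, hnorm]
    rw [integral_const_mul, integral_mul_const, norm_cpow_eq_rpow_re_of_pos (hx i), neg_re,
      ofReal_re]
    ring
  have h := hasSum_integral_of_summable_integral_norm hint hsum
  have h2 := h.mul_left ((1 / (2 * Real.pi) : ℝ) : ℂ)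
  have e2 : VI σ (fun s => W s * D s) = ((1 / (2 * Real.pi) : ℝ) : ℂ) *
      ∫ u : ℝ, ∑' i, α i * (W (σ + u * I) * (x i : ℂ) ^ (-(σ + u * I : ℂ))) := by
    rw [VI]
    congr 2
    funext u
    rw [← (hD _ (line_re σ u)).tsum_eq, ← tsum_mul_left]
    exact tsum_congr fun i => by ring
  rw [e2]
  refine HasSum.congr_fun h2 fun i => ?_
  rw [VI, integral_const_mul]
  ring

section Estermann

variable {N : ℕ} [NeZero N]

lemma hasSum_estermann (a : ZMod N) {s : ℂ} (hs : 1 < s.re) :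
    HasSum (fun n : ℕ+ => ((n : ℕ).divisors.card : ℂ) * stdAddChar (a * ((n : ℕ) : ZMod N)) *
      ((n : ℕ) : ℂ) ^ (-s)) (estermann a s) := by
  have h := LSeriesHasSum_estermann a hs
  rw [LSeriesHasSum, ← PNat.coe_injective.hasSum_iff] at h
  · refine HasSum.congr_fun h fun n => ?_
    rw [Function.comp_apply, LSeries.term_of_ne_zero n.ne_zero, cpow_neg, div_eq_mul_inv]
  · intro n hn
    have : n = 0 := by
      by_contra h0
      exact hn ⟨⟨n, Nat.pos_of_ne_zero h0⟩, rfl⟩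
    rw [this, LSeries.term_zero]

lemma exists_norm_estermann_le (a : ZMod N) {σ : ℝ} (hσ : 1 < σ) :
    ∃ M, 0 ≤ M ∧ ∀ s : ℂ, s.re = σ → ‖estermann a s‖ ≤ M := by
  have hsum := (hasSum_estermann a (s := σ) (by simpa)).summable.norm
  refine ⟨_, hsum.hasSum.nonneg fun _ => norm_nonneg _, fun s hs => ?_⟩
  have h := hasSum_estermann a (s := s) (by rwa [hs])
  rw [← h.tsum_eq]
  refine tsum_of_norm_bounded hsum.hasSum fun n => ?_
  have hn : 0 < (n : ℕ) := n.pos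
  rw [norm_mul, norm_mul, norm_mul, norm_mul, norm_natCast_cpow_of_pos hn, norm_natCast_cpow_of_pos hn]
  simp [hs]

lemma norm_le_two_add_abs_im {s : ℂ} (h : |s.re| = 2) : ‖s‖ ≤ 2 * (1 + |s.im|) := by
  have := norm_le_abs_re_add_abs_im s
  have := abs_nonneg s.im
  linarith

lemma exists_norm_entireEst_mul_mellin_le {a b : ZMod N} (hab : a * b = 1) {Φ : ℝ → ℂ}
    (hΦ : IsTest Φ) : ∃ C, ∀ s : ℂ, -2 ≤ s.re → s.re ≤ 2 →
      ‖entireEst a s * mellin Φ s‖ ≤ C := by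
  obtain ⟨M, hM0, hM⟩ := exists_norm_estermann_le a (σ := 3) (by norm_num)
  obtain ⟨M1, hM10, hM1⟩ := exists_norm_estermann_le b (σ := 2) (by norm_num)
  obtain ⟨M2, hM20, hM2⟩ := exists_norm_estermann_le (-b) (σ := 2) (by norm_num)
  obtain ⟨C₁, K, hC₁, hG⟩ := exists_norm_G1_le (a := 2) two_pos 2
  obtain ⟨F₁, hF₁0, hF₁⟩ := hΦ.exists_norm_mellin_le' 2 2 2
  obtain ⟨F₂, hF₂0, hF₂⟩ := hΦ.exists_norm_mellin_le' (K + 2) (-2) (-2)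
  have hright (s : ℂ) (hs : s.re = 2) : ‖entireEst a s * mellin Φ s‖ ≤ 4 * M * F₁ := by
    have hs0 : s ≠ 0 := by
      rintro rfl
      norm_num at hs
    have h1 := hM (1 + s) (by rw [add_re, hs, one_re]; norm_num)
    have h2 := hF₁ s hs.ge hs.le
    have h3 := norm_le_two_add_abs_im (s := s) (by rw [hs]; norm_num)
    rw [entireEst_of_ne a hs0, norm_mul, norm_mul, norm_pow]
    calc ‖s‖ ^ 2 * ‖estermann a (1 + s)‖ * ‖mellin Φ s‖
        ≤ (2 * (1 + |s.im|)) ^ 2 * M * ‖mellin Φ s‖ := by gcongr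
      _ = 4 * M * ((1 + |s.im|) ^ 2 * ‖mellin Φ s‖) := by ring
      _ ≤ 4 * M * F₁ := by gcongr
  have hleft (s : ℂ) (hs : s.re = -2) : ‖entireEst a s * mellin Φ s‖ ≤
      4 * ((N : ℝ)⁻¹ * (N : ℝ) ^ (4 : ℝ) * (C₁ * (M1 + M2))) * F₂ := by
    have hs0 : s ≠ 0 := by
      rintro rfl
      norm_num at hs
    have hns : (-s).re = 2 := by rw [neg_re, hs, neg_neg]
    have h1 := hM1 (-s) hns
    have h1' := hM2 (-s) hns
    have h2 := hF₂ s hs.ge hs.le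
    have h3 := norm_le_two_add_abs_im (s := s) (by rw [hs]; norm_num)
    obtain ⟨h4, h5⟩ := hG (-s) hns.ge hns.le
    rw [neg_im, abs_neg] at h4 h5
    have hfe := estermann_one_sub hab (s := -s) (by rw [hns]; norm_num)
    rw [sub_neg_eq_add] at hfe
    have hN : ‖(N : ℂ) ^ (2 * -s)‖ = (N : ℝ) ^ (4 : ℝ) := by
      rw [norm_natCast_cpow_of_pos (Nat.pos_of_ne_zero (NeZero.ne N))]
      congr 1
      simp [hs]
      norm_num
    rw [entireEst_of_ne a hs0, hfe, norm_mul, norm_mul, norm_pow, norm_mul, norm_mul, hN, norm_inv,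
      norm_natCast]
    have h6 : ‖G1p (-s) * estermann b (-s) + G1m (-s) * estermann (-b) (-s)‖ ≤
        C₁ * (1 + |s.im|) ^ K * (M1 + M2) := by
      refine (norm_add_le _ _).trans ?_
      rw [norm_mul, norm_mul, mul_add]
      gcongr
    calc ‖s‖ ^ 2 * ((N : ℝ)⁻¹ * (N : ℝ) ^ (4 : ℝ) *
          ‖G1p (-s) * estermann b (-s) + G1m (-s) * estermann (-b) (-s)‖) * ‖mellin Φ s‖
        ≤ (2 * (1 + |s.im|)) ^ 2 * ((N : ℝ)⁻¹ * (N : ℝ) ^ (4 : ℝ) *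
          (C₁ * (1 + |s.im|) ^ K * (M1 + M2))) * ‖mellin Φ s‖ := by gcongr
      _ = 4 * ((N : ℝ)⁻¹ * (N : ℝ) ^ (4 : ℝ) * (C₁ * (M1 + M2))) *
          ((1 + |s.im|) ^ (K + 2) * ‖mellin Φ s‖) := by ring
      _ ≤ _ := by gcongr
  refine ⟨max (4 * M * F₁) (4 * ((N : ℝ)⁻¹ * (N : ℝ) ^ (4 : ℝ) * (C₁ * (M1 + M2))) * F₂),
    fun s h1 h2 => ?_⟩
  refine PhragmenLindelof.vertical_strip (a := -2) (b := 2)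
    (f := fun s => entireEst a s * mellin Φ s) ?_ ⟨1 / 2, ?_, ?_⟩
    (fun z hz => (hleft z hz).trans (le_max_right _ _))
    (fun z hz => (hright z hz).trans (le_max_left _ _)) h1 h2
  · exact ((differentiable_entireEst a).mul hΦ.differentiable_mellin).diffContOnCl
  · have := Real.pi_gt_three
    norm_num
    linarith
  · have hF : ExpGrowth (mellin Φ) := ExpGrowth.of_bounded fun a b => by
      obtain ⟨C, hC⟩ := mellin_bounded_of_convergent hΦ.mellinConvergent a b
      exact ⟨C, fun z h1 h2 _ => hC z h1 h2⟩
    obtain ⟨C, A, hC0, hA0, hCA⟩ := ((expGrowth_entireEst a).mul hF) (-2) 2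
    refine ⟨2 * A, Asymptotics.IsBigO.of_bound C ?_⟩
    have hev : ∀ᶠ z : ℂ in comap (fun z : ℂ => |z.im|) atTop, 1 ≤ |z.im| :=
      tendsto_comap.eventually (eventually_ge_atTop 1)
    rw [eventually_inf_principal]
    filter_upwards [hev] with z hz hzs
    refine (hCA z hzs.1.le hzs.2.le hz).trans ?_
    rw [Real.norm_of_nonneg (Real.exp_pos _).le]
    have := Real.add_one_le_exp (1 / 2 * |z.im|)
    refine mul_le_mul_of_nonneg_left (Real.exp_le_exp.2 ?_) hC0
    nlinarith

lemma VI_mellin_mul_estermann {a b : ZMod N} (hab : a * b = 1) {Φ : ℝ → ℂ} (hΦ : IsTest Φ) :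
    VI 2 (fun s => mellin Φ s * estermann a (1 + s)) =
      (2 * ((Real.eulerMascheroniConstant - Complex.log N) / N) * mellin Φ 0 +
        (N : ℂ)⁻¹ * mellin (fun t => Real.log t • Φ t) 0) +
      VI 2 (fun s => mellin Φ (-s) * estermann a (1 - s)) := by
  obtain ⟨C, hC⟩ := exists_norm_entireEst_mul_mellin_le hab hΦ
  have h := VI_shift_double_pole ((differentiable_entireEst a).mul hΦ.differentiable_mellin)
    two_pos hC
  have hder := ((differentiable_entireEst a 0).hasDerivAt.mul (hΦ.hasDerivAt_mellin 0)).deriv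
  rw [deriv_entireEst_zero hab, entireEst_zero hab] at hder
  rw [hder, VI_neg] at h
  have hne {σ : ℝ} (hσ : σ ≠ 0) {s : ℂ} (hs : s.re = σ) : s ≠ 0 := by
    rintro rfl
    exact hσ hs.symm
  have e1 : VI 2 (fun s => mellin Φ s * estermann a (1 + s)) =
      VI 2 (fun s => (entireEst a * mellin Φ) s / s ^ 2) := VI_congr fun s hs => by
    have hs0 := hne two_ne_zero hs
    rw [Pi.mul_apply, entireEst_of_ne a hs0]
    field_simp
  have e2 : VI 2 (fun s => mellin Φ (-s) * estermann a (1 - s)) =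
      VI 2 (fun s => (entireEst a * mellin Φ) (-s) / (-s) ^ 2) := VI_congr fun s hs => by
    have hs0 := hne two_ne_zero hs
    rw [Pi.mul_apply, entireEst_of_ne a (neg_ne_zero.2 hs0), ← sub_eq_add_neg]
    field_simp
  rw [e1, e2, h]

lemma stdAddChar_mul_natCast (h : ℤ) (n : ℕ) :
    stdAddChar ((h : ZMod N) * ((n : ℕ) : ZMod N)) = e ((n : ℂ) * h / N) := by
  have : (h : ZMod N) * ((n : ℕ) : ZMod N) = ((h * n : ℤ) : ZMod N) := by push_cast; rfl
  rw [this, stdAddChar_coe, e]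
  congr 1
  push_cast
  ring

lemma differentiableAt_estermann (a : ZMod N) {s : ℂ} (hs : s ≠ 1) :
    DifferentiableAt ℂ (estermann a) s := by
  unfold estermann
  have h (f : ZMod N → ℂ) : DifferentiableAt ℂ (LFunction f) s :=
    differentiableAt_LFunction f s (Or.inl hs)
  fun_prop

lemma hasSum_twisted_values (a : ZMod N) {Φ : ℝ → ℂ} (hΦ : IsTest Φ) :
    HasSum (fun n : ℕ+ => ((n : ℕ).divisors.card : ℂ) / ((n : ℕ) : ℂ) *
      stdAddChar (a * ((n : ℕ) : ZMod N)) * Φ ((n : ℕ) : ℝ))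
      (VI 2 fun s => mellin Φ s * estermann a (1 + s)) := by
  have h := hasSum_VI (ι := ℕ+) (x := fun n => (n : ℕ)) (σ := 2)
    (α := fun n => ((n : ℕ).divisors.card : ℂ) / ((n : ℕ) : ℂ) *
      stdAddChar (a * ((n : ℕ) : ZMod N))) (D := fun s => estermann a (1 + s))
    (fun n => Nat.cast_pos.2 n.pos) ((hΦ.stripDecay_mellin 2 2).integrable le_rfl le_rfl) fun s hs => by
      have := hasSum_estermann a (s := 1 + s) (by rw [add_re, hs, one_re]; norm_num)
      refine HasSum.congr_fun this fun n => ?_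
      have hn : ((n : ℕ) : ℂ) ≠ 0 := Nat.cast_ne_zero.2 n.ne_zero
      rw [neg_add, cpow_add _ _ hn, cpow_neg_one, ofReal_natCast]
      ring
  refine HasSum.congr_fun h fun n => ?_
  rw [VI_mellin hΦ 2 (Nat.cast_pos.2 n.pos)]

lemma hasSum_dual (a : ZMod N) {W : ℂ → ℂ} (hW : Integrable fun u : ℝ => W (((2 : ℝ) : ℂ) + u * I)) :
    HasSum (fun r : ℕ+ => ((r : ℕ).divisors.card : ℂ) * stdAddChar (a * ((r : ℕ) : ZMod N)) *
      VI 2 fun s => W s * ((((r : ℕ) : ℝ) / (N : ℝ) ^ 2 : ℝ) : ℂ) ^ (-s))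
      (VI 2 fun s => W s * ((N : ℂ) ^ (2 * s) * estermann a s)) := by
  have hN : 0 < (N : ℝ) := Nat.cast_pos.2 (Nat.pos_of_ne_zero (NeZero.ne N))
  refine hasSum_VI (ι := ℕ+) (x := fun r => ((r : ℕ) : ℝ) / (N : ℝ) ^ 2)
    (fun r => div_pos (Nat.cast_pos.2 r.pos) (by positivity)) hW fun s hs => ?_
  have := (hasSum_estermann a (s := s) (by rw [hs]; norm_num)).mul_left ((N : ℂ) ^ (2 * s))
  refine HasSum.congr_fun this fun r => ?_
  have h1 : ((((r : ℕ) : ℝ) / (N : ℝ) ^ 2 : ℝ) : ℂ) ^ (-s) =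
      ((r : ℕ) : ℂ) ^ (-s) * (N : ℂ) ^ (2 * s) := by
    rw [div_eq_mul_inv, ofReal_mul, mul_cpow_ofReal_nonneg (by positivity) (by positivity)]
    congr 1
    rw [cpow_neg, ofReal_inv, inv_cpow_eq_ite, if_neg, inv_inv, ofReal_pow, ofReal_natCast,
      ← natCast_cpow_natCast_mul]
    · push_cast; rfl
    · rw [arg_ofReal_of_nonneg (by positivity)]
      exact Real.pi_pos.ne
  rw [h1]
  ring

lemma VI_dual_eq {a b : ZMod N} (hab : a * b = 1) {Φ : ℝ → ℂ} (hΦ : IsTest Φ) :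
    HasSum (fun r : ℕ+ => ((r : ℕ).divisors.card : ℂ) *
      (stdAddChar (b * ((r : ℕ) : ZMod N)) * checkPlus Φ 2 (((r : ℕ) : ℝ) / (N : ℝ) ^ 2) +
        stdAddChar (-b * ((r : ℕ) : ZMod N)) * checkMinus Φ 2 (((r : ℕ) : ℝ) / (N : ℝ) ^ 2)))
      (N * VI 2 fun s => mellin Φ (-s) * estermann a (1 - s)) := by
  have hN : (N : ℂ) ≠ 0 := Nat.cast_ne_zero.2 (NeZero.ne N)
  obtain ⟨hp, hm⟩ := stripDecay_G1_mul_mellin hΦ (a := 2) two_pos 2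
  have hip := hp.integrable le_rfl le_rfl
  have him := hm.integrable le_rfl le_rfl
  have h := (hasSum_dual b (W := fun s => G1p s * mellin Φ (-s)) hip).add
    (hasSum_dual (-b) (W := fun s => G1m s * mellin Φ (-s)) him)
  have hint (c : ZMod N) {W : ℂ → ℂ}
      (hW : Integrable fun u : ℝ => W (((2 : ℝ) : ℂ) + u * I)) :
      Integrable fun u : ℝ => W (((2 : ℝ) : ℂ) + u * I) *
        ((N : ℂ) ^ (2 * (((2 : ℝ) : ℂ) + u * I)) * estermann c (((2 : ℝ) : ℂ) + u * I)) := by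
    obtain ⟨M, hM0, hM⟩ := exists_norm_estermann_le c (σ := 2) (by norm_num)
    refine hW.mul_bdd (c := (N : ℝ) ^ (4 : ℝ) * M) ?_ (.of_forall fun u => ?_)
    · refine Continuous.aestronglyMeasurable ?_
      refine (Continuous.const_cpow (by fun_prop) (Or.inl hN)).mul ?_
      have hl : Continuous fun u : ℝ => ((2 : ℝ) : ℂ) + u * I := by fun_prop
      refine continuous_iff_continuousAt.2 fun u =>
        (differentiableAt_estermann c fun h => ?_).continuousAt.comp' hl.continuousAt
      have := congrArg re h
      rw [line_re, one_re] at this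
      norm_num at this
    · rw [norm_mul, norm_natCast_cpow_of_pos (Nat.pos_of_ne_zero (NeZero.ne N))]
      have h4 : (2 * (((2 : ℝ) : ℂ) + u * I)).re = 4 := by
        simp
        norm_num
      rw [h4]
      gcongr
      exact hM _ (line_re 2 u)
  rw [← VI_add (f := fun s => G1p s * mellin Φ (-s) * ((N : ℂ) ^ (2 * s) * estermann b s))
    (g := fun s => G1m s * mellin Φ (-s) * ((N : ℂ) ^ (2 * s) * estermann (-b) s))
    (hint b (W := fun s => G1p s * mellin Φ (-s)) hip)
    (hint (-b) (W := fun s => G1m s * mellin Φ (-s)) him)] at h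
  have e1 : (N * VI 2 fun s => mellin Φ (-s) * estermann a (1 - s)) =
      VI 2 fun s => G1p s * mellin Φ (-s) * ((N : ℂ) ^ (2 * s) * estermann b s) +
        G1m s * mellin Φ (-s) * ((N : ℂ) ^ (2 * s) * estermann (-b) s) := by
    rw [← VI_const_mul]
    refine VI_congr fun s hs => ?_
    rw [estermann_one_sub hab (by rw [hs]; norm_num)]
    field_simp
  rw [e1]
  refine HasSum.congr_fun h fun r => ?_
  simp only [checkPlus, checkMinus, mellinT_eq]
  ring

end Estermann

end Voronoi

open Voronoi

/-- Voronoi summation for the divisor function. -/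
theorem voronoi_divisor (Φ : ℝ → ℂ) (hΦ : ContDiff ℝ (⊤ : ℕ∞) Φ) (hcs : HasCompactSupport Φ)
    (hsupp : tsupport Φ ⊆ Ioi (0 : ℝ)) (c : ℕ) (hc : 0 < c) (h hbar : ℤ)
    (hcop : Int.gcd h (c : ℤ) = 1) (hinv : h * hbar ≡ 1 [ZMOD (c : ℤ)])
    (σ : ℝ) (hσ : 0 < σ) :
    Summable (fun r : ℕ+ => ((r : ℕ).divisors.card : ℂ) *
      (e (((r : ℕ) : ℂ) * (h : ℂ) / (c : ℂ)) * checkPlus Φ σ (((r : ℕ) : ℝ) / (c : ℝ) ^ 2) +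
       e (-(((r : ℕ) : ℂ) * (h : ℂ)) / (c : ℂ)) * checkMinus Φ σ (((r : ℕ) : ℝ) / (c : ℝ) ^ 2))) ∧
    ∑' n : ℕ+, (((n : ℕ).divisors.card : ℂ) / ((n : ℕ) : ℂ)) *
        e (((n : ℕ) : ℂ) * (hbar : ℂ) / (c : ℂ)) * Φ ((n : ℕ) : ℝ)
      = (1 / (c : ℂ)) * (∫ x in Ioi (0 : ℝ),
          ((Real.log (x / (c : ℝ) ^ 2) + 2 * Real.eulerMascheroniConstant : ℝ) : ℂ)
            * Φ x / (x : ℂ))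
      + (1 / (c : ℂ)) * ∑' r : ℕ+, ((r : ℕ).divisors.card : ℂ) *
          (e (((r : ℕ) : ℂ) * (h : ℂ) / (c : ℂ)) * checkPlus Φ σ (((r : ℕ) : ℝ) / (c : ℝ) ^ 2) +
           e (-(((r : ℕ) : ℂ) * (h : ℂ)) / (c : ℂ)) * checkMinus Φ σ (((r : ℕ) : ℝ) / (c : ℝ) ^ 2)) := by
  have : NeZero c := ⟨hc.ne'⟩
  have hT : IsTest Φ := ⟨hΦ, hcs, hsupp⟩
  have hc0 : (c : ℂ) ≠ 0 := Nat.cast_ne_zero.2 hc.ne'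
  have hcR : (0 : ℝ) < c := Nat.cast_pos.2 hc
  have hab : ((hbar : ZMod c) * (h : ZMod c)) = 1 := by
    have := (ZMod.intCast_eq_intCast_iff (h * hbar) 1 c).2 hinv
    push_cast at this
    rw [mul_comm, this]
  have hpos (r : ℕ+) : 0 < ((r : ℕ) : ℝ) / (c : ℝ) ^ 2 :=
    div_pos (Nat.cast_pos.2 r.pos) (by positivity)
  have hterm (r : ℕ+) : ((r : ℕ).divisors.card : ℂ) *
      (e (((r : ℕ) : ℂ) * (h : ℂ) / (c : ℂ)) * checkPlus Φ σ (((r : ℕ) : ℝ) / (c : ℝ) ^ 2) +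
       e (-(((r : ℕ) : ℂ) * (h : ℂ)) / (c : ℂ)) * checkMinus Φ σ (((r : ℕ) : ℝ) / (c : ℝ) ^ 2)) =
      ((r : ℕ).divisors.card : ℂ) *
      (ZMod.stdAddChar ((h : ZMod c) * ((r : ℕ) : ZMod c)) *
          checkPlus Φ 2 (((r : ℕ) : ℝ) / (c : ℝ) ^ 2) +
        ZMod.stdAddChar (-(h : ZMod c) * ((r : ℕ) : ZMod c)) *
          checkMinus Φ 2 (((r : ℕ) : ℝ) / (c : ℝ) ^ 2)) := by
    rw [← Int.cast_neg, stdAddChar_mul_natCast, stdAddChar_mul_natCast,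
      checkPlus_eq hT hσ two_pos (hpos r), checkMinus_eq hT hσ two_pos (hpos r)]
    push_cast
    rw [mul_neg]
  have hdual := HasSum.congr_fun (VI_dual_eq hab hT) hterm
  refine ⟨hdual.summable, ?_⟩
  have hleft := hasSum_twisted_values (hbar : ZMod c) hT
  simp only [stdAddChar_mul_natCast] at hleft
  rw [hdual.tsum_eq, hleft.tsum_eq, VI_mellin_mul_estermann hab hT, ← mul_assoc,
    one_div_mul_cancel hc0, one_mul]
  congr 1
  have hi1 : IntegrableOn (fun x : ℝ => (Real.log x : ℂ) * Φ x / x) (Ioi 0) := by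
    have hl : ContinuousOn (fun x : ℝ => (Real.log x : ℂ) / x) (Ioi 0) :=
      (Complex.continuous_ofReal.comp_continuousOn (Real.continuousOn_log.mono fun x hx =>
        ne_of_gt hx)).div Complex.continuous_ofReal.continuousOn fun x hx =>
          Complex.ofReal_ne_zero.2 (ne_of_gt hx)
    refine (hT.integrable_mul hl).integrableOn.congr_fun (fun x _ => ?_) measurableSet_Ioi
    exact div_mul_eq_mul_div _ _ _
  have hi2 : IntegrableOn (fun x : ℝ => Φ x * (x : ℂ) ^ ((0 : ℂ) - 1)) (Ioi 0) :=
    (hT.integrable_mul (IsTest.continuousOn_cpow _)).integrableOn.congr_fun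
      (fun x _ => mul_comm _ _) measurableSet_Ioi
  have hint : ∫ x in Ioi (0 : ℝ),
      ((Real.log (x / (c : ℝ) ^ 2) + 2 * Real.eulerMascheroniConstant : ℝ) : ℂ) * Φ x / (x : ℂ) =
      mellin (fun t => Real.log t • Φ t) 0 +
        2 * (Real.eulerMascheroniConstant - Complex.log c) * mellin Φ 0 := by
    rw [IsTest.mellin_log_zero, ← mellinT_eq, mellinT, ← integral_const_mul,
      ← integral_add hi1 (hi2.const_mul _)]
    refine setIntegral_congr_fun measurableSet_Ioi fun x hx => ?_
    have hx0 : (x : ℂ) ≠ 0 := Complex.ofReal_ne_zero.2 (ne_of_gt hx)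
    have hlog : Real.log (x / (c : ℝ) ^ 2) = Real.log x - 2 * Real.log c := by
      rw [Real.log_div (ne_of_gt hx) (by positivity), Real.log_pow]
      push_cast
      ring
    simp only [hlog, zero_sub, Complex.cpow_neg_one]
    push_cast
    field_simp
    ring
  rw [hint]
  field_simp
  ring
end

section
/- For every positive integer m and every complex s with Re(s) > 1, the series ∑_{c=1}^∞ r_c(m)/c^s converges absolutely and equals σ_{s−1}(m) / (m^{s−1} ζ(s)), where ζ is the Riemann zeta function (which is nonzero for Re(s) > 1). -/
/-- The Ramanujan sum `r_c(m) = ∑_{h mod c, (h,c)=1} e(mh/c)`. -/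
noncomputable def ramanujanSum (c m : ℕ) : ℂ :=
  ∑ h ∈ (Finset.range c).filter (fun h => Nat.Coprime h c),
    e ((m : ℂ) * (h : ℂ) / (c : ℂ))

/-- `σ_w(m) = ∑_{d ∣ m} d^w`, with `d^w = exp(w log d)`. -/
noncomputable def sigmaC (w : ℂ) (m : ℕ) : ℂ := ∑ d ∈ m.divisors, (d : ℂ) ^ w

/-- The complete exponential sum `∑_{h mod n} e(mh/n)` is `n` if `n ∣ m` and `0` otherwise. -/
lemma sum_range_e (m : ℕ) {n : ℕ} (hn : 0 < n) :
    ∑ h ∈ Finset.range n, e ((m : ℂ) * (h : ℂ) / (n : ℂ)) = if n ∣ m then (n : ℂ) else 0 := by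
  have hn' : (n : ℂ) ≠ 0 := by exact_mod_cast hn.ne'
  have hprim := Complex.isPrimitiveRoot_exp n hn.ne'
  set ζ : ℂ := Complex.exp (2 * Real.pi * Complex.I / n) with hζ
  have hterm : ∀ h : ℕ, e ((m : ℂ) * (h : ℂ) / (n : ℂ)) = (ζ ^ m) ^ h := by
    intro h
    rw [e, hζ, ← Complex.exp_nat_mul, ← Complex.exp_nat_mul]
    congr 1
    field_simp
  simp_rw [hterm]
  split_ifs with hdvd
  · simp [(hprim.pow_eq_one_iff_dvd m).2 hdvd]
  · have hne : ζ ^ m ≠ 1 := fun h => hdvd ((hprim.pow_eq_one_iff_dvd m).1 h)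
    rw [geom_sum_eq hne, ← pow_mul, mul_comm, pow_mul, hprim.pow_eq_one, one_pow, sub_self,
      zero_div]

/-- Grouping the residues `h` mod `n` by `gcd(n, h)` splits the complete exponential sum into
Ramanujan sums. -/
lemma sum_divisors_ramanujanSum (m : ℕ) {n : ℕ} (hn : 0 < n) :
    ∑ d ∈ n.divisors, ramanujanSum d m = if n ∣ m then (n : ℂ) else 0 := by
  rw [← sum_range_e m hn, ← Nat.sum_div_divisors n (fun d => ramanujanSum d m),
    ← Finset.sum_fiberwise_of_maps_to (s := Finset.range n) (t := n.divisors)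
      (g := fun h => n.gcd h)
      (fun h _ => Nat.mem_divisors.2 ⟨Nat.gcd_dvd_left n h, hn.ne'⟩)]
  refine Finset.sum_congr rfl fun d hd => ?_
  obtain ⟨⟨k, rfl⟩, -⟩ := Nat.mem_divisors.1 hd
  have hd0 : 0 < d := Nat.pos_of_mul_pos_right hn
  have hdC : (d : ℂ) ≠ 0 := by exact_mod_cast hd0.ne'
  rw [Nat.mul_div_cancel_left k hd0, ramanujanSum]
  refine Finset.sum_nbij' (fun h => d * h) (fun h => h / d) ?_ ?_ ?_ ?_ ?_
  · intro h hh
    simp only [Finset.mem_filter, Finset.mem_range] at hh ⊢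
    refine ⟨Nat.mul_lt_mul_of_pos_left hh.1 hd0, ?_⟩
    rw [Nat.gcd_mul_left, Nat.gcd_comm, hh.2.gcd_eq_one, mul_one]
  · intro h hh
    simp only [Finset.mem_filter, Finset.mem_range] at hh ⊢
    obtain ⟨j, rfl⟩ : d ∣ h := hh.2 ▸ Nat.gcd_dvd_right _ _
    rw [Nat.mul_div_cancel_left j hd0]
    refine ⟨Nat.lt_of_mul_lt_mul_left hh.1, ?_⟩
    have := hh.2
    rw [Nat.gcd_mul_left] at this
    rw [Nat.coprime_comm]
    exact Nat.eq_of_mul_eq_mul_left hd0 (by rw [this, mul_one])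
  · intro h _
    exact Nat.mul_div_cancel_left h hd0
  · intro h hh
    simp only [Finset.mem_filter] at hh
    exact Nat.mul_div_cancel' (hh.2 ▸ Nat.gcd_dvd_right _ _)
  · intro h _
    congr 1
    push_cast
    rw [mul_left_comm, mul_div_mul_left _ _ hdC]

/-- `c ↦ r_c(m)` as an arithmetic function. -/
noncomputable def ramanujanArith (m : ℕ) : ArithmeticFunction ℂ :=
  ⟨fun c => ramanujanSum c m, by simp [ramanujanSum]⟩

/-- The arithmetic function with value `n` at the divisors `n` of `m` and `0` elsewhere. -/
def divisorIndicator (m : ℕ) : ArithmeticFunction ℂ :=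
  ⟨fun n => if n ∣ m then (n : ℂ) else 0, by simp⟩

open ArithmeticFunction in
lemma ramanujanArith_eq (m : ℕ) :
    ramanujanArith m = divisorIndicator m * ((moebius : ArithmeticFunction ℤ) :
      ArithmeticFunction ℂ) := by
  have h : ramanujanArith m * ((zeta : ArithmeticFunction ℕ) : ArithmeticFunction ℂ)
      = divisorIndicator m := by
    ext n
    rcases Nat.eq_zero_or_pos n with rfl | hn
    · simp
    · rw [coe_mul_zeta_apply]
      exact sum_divisors_ramanujanSum m hn
  rw [← h, mul_assoc, coe_zeta_mul_coe_moebius, mul_one]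

lemma LSeriesHasSum_divisorIndicator {m : ℕ} (hm : 0 < m) (s : ℂ) :
    LSeriesHasSum (fun n => divisorIndicator m n) s (sigmaC (s - 1) m / (m : ℂ) ^ (s - 1)) := by
  have hsum : sigmaC (s - 1) m / (m : ℂ) ^ (s - 1)
      = ∑ d ∈ m.divisors, LSeries.term (fun n => divisorIndicator m n) s d := by
    rw [sigmaC, ← Nat.sum_div_divisors, Finset.sum_div]
    refine Finset.sum_congr rfl fun d hd => ?_
    obtain ⟨⟨k, rfl⟩, -⟩ := Nat.mem_divisors.1 hd
    have hd0 : 0 < d := Nat.pos_of_mul_pos_right hm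
    have hk0 : 0 < k := Nat.pos_of_mul_pos_left hm
    have hdC : (d : ℂ) ≠ 0 := by exact_mod_cast hd0.ne'
    have hkC : (k : ℂ) ≠ 0 := by exact_mod_cast hk0.ne'
    have hds : (d : ℂ) ^ s ≠ 0 := by simp [Complex.cpow_eq_zero_iff, hdC]
    have hks : (k : ℂ) ^ (s - 1) ≠ 0 := by simp [Complex.cpow_eq_zero_iff, hkC]
    rw [LSeries.term_of_ne_zero hd0.ne', Nat.mul_div_cancel_left k hd0, Nat.cast_mul,
      Complex.natCast_mul_natCast_cpow, Complex.cpow_sub _ _ hdC, Complex.cpow_one]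
    simp only [divisorIndicator, ArithmeticFunction.coe_mk, dvd_mul_right, if_true]
    field_simp
  rw [LSeriesHasSum, hsum]
  refine hasSum_sum_of_ne_finset_zero fun n hn => ?_
  have : ¬ n ∣ m := fun h => hn (Nat.mem_divisors.2 ⟨h, hm.ne'⟩)
  simp [LSeries.term, divisorIndicator, this]

/-- The Dirichlet series of Ramanujan sums:
`∑_{c≥1} r_c(m)/c^s = σ_{s−1}(m)/(m^{s−1} ζ(s))` for `Re(s) > 1`. -/
theorem ramanujan_dirichlet_series (m : ℕ) (hm : 0 < m) (s : ℂ) (hs : 1 < s.re) :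
    riemannZeta s ≠ 0 ∧
    Summable (fun c : ℕ+ => ramanujanSum (c : ℕ) m / ((c : ℕ) : ℂ) ^ s) ∧
    ∑' c : ℕ+, ramanujanSum (c : ℕ) m / ((c : ℕ) : ℂ) ^ s
      = sigmaC (s - 1) m / (((m : ℂ) ^ (s - 1)) * riemannZeta s) := by
  have hζ := riemannZeta_ne_zero_of_one_lt_re hs
  have hμ := (ArithmeticFunction.LSeriesSummable_moebius_iff.2 hs).LSeriesHasSum
  have hμζ := ArithmeticFunction.LSeries_zeta_mul_Lseries_moebius hs
  rw [ArithmeticFunction.LSeries_zeta_eq_riemannZeta hs] at hμζ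
  rw [eq_inv_of_mul_eq_one_right hμζ] at hμ
  have hN : LSeriesHasSum (fun n => ramanujanArith m n) s
      (sigmaC (s - 1) m / (m : ℂ) ^ (s - 1) * (riemannZeta s)⁻¹) := by
    rw [ramanujanArith_eq]
    exact ArithmeticFunction.LSeriesHasSum_mul (LSeriesHasSum_divisorIndicator hm s) hμ
  have hP : HasSum (fun c : ℕ+ => ramanujanSum (c : ℕ) m / ((c : ℕ) : ℂ) ^ s)
      (sigmaC (s - 1) m / (((m : ℂ) ^ (s - 1)) * riemannZeta s)) := by
    rw [← div_div, div_eq_mul_inv _ (riemannZeta s)]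
    convert (PNat.coe_injective.hasSum_iff fun n hn => ?_).2 hN using 2 with c
    · simp [ramanujanArith]
    · rcases Nat.eq_zero_or_pos n with rfl | hpos
      · simp
      · exact absurd ⟨⟨n, hpos⟩, rfl⟩ hn
  exact ⟨hζ, hP.summable, hP.tsum_eq⟩
end

section
/- Let a, b, s be complex numbers with Re(s) > 1, Re(s−a) > 1, Re(s−b) > 1, and Re(s−a−b) > 1. Then the series ∑_{m=1}^∞ σ_a(m) σ_b(m) / m^s converges absolutely and equals ζ(s) ζ(s−a) ζ(s−b) ζ(s−a−b) / ζ(2s−a−b), where ζ is the Riemann zeta function. -/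
theorem hasSum_pnat_cpow_neg {w : ℂ} (hw : 1 < w.re) :
    HasSum (fun n : ℕ+ => ((n : ℕ) : ℂ) ^ (-w)) (riemannZeta w) := by
  have hne : w ≠ 0 := by rintro rfl; simp at hw; linarith
  have h : HasSum (fun n : ℕ => (n : ℂ) ^ (-w)) (riemannZeta w) := by
    rw [zeta_eq_tsum_one_div_nat_cpow hw]
    simpa [Complex.cpow_neg] using (Complex.summable_one_div_nat_cpow.mpr hw).hasSum
  refine (PNat.coe_injective.hasSum_iff fun n hn => ?_).mpr h
  obtain rfl : n = 0 := by
    by_contra h0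
    exact hn ⟨⟨n, Nat.pos_of_ne_zero h0⟩, rfl⟩
  simp [hne]

theorem HasSum.mul_complex {ι κ : Type*} {f : ι → ℂ} {g : κ → ℂ} {x y : ℂ}
    (hf : HasSum f x) (hg : HasSum g y) :
    HasSum (fun p : ι × κ => f p.1 * g p.2) (x * y) :=
  hf.mul hg (summable_mul_of_summable_norm hf.summable.norm hg.summable.norm)

/-- Ordered pairs of coprime positive integers. -/
abbrev CoprimePair : Type := {p : ℕ+ × ℕ+ // Nat.Coprime p.1 p.2}

theorem CoprimePair.mul_injective :
    Function.Injective fun q : ℕ+ × CoprimePair =>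
      (((q.1 * q.2.1.1 : ℕ+) : ℕ), ((q.1 * q.2.1.2 : ℕ+) : ℕ)) := by
  rintro ⟨g, ⟨⟨d, e⟩, h⟩⟩ ⟨g', ⟨⟨d', e'⟩, h'⟩⟩ heq
  simp only [Prod.mk.injEq, PNat.mul_coe] at heq h h'
  obtain ⟨h1, h2⟩ := heq
  have hg : (g : ℕ) = g' := by
    have := congrArg₂ Nat.gcd h1 h2
    rwa [Nat.gcd_mul_left, Nat.gcd_mul_left, h.gcd_eq_one, h'.gcd_eq_one, mul_one, mul_one]
      at this
  rw [hg] at h1 h2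
  have hd := Nat.eq_of_mul_eq_mul_left g'.pos h1
  have he := Nat.eq_of_mul_eq_mul_left g'.pos h2
  simp only [PNat.coe_inj] at hg hd he
  subst hg hd he
  rfl

theorem CoprimePair.exists_mul_eq {m n : ℕ} (hm : 0 < m) (hn : 0 < n) :
    ∃ (g : ℕ+) (p : CoprimePair), (g : ℕ) * p.1.1 = m ∧ (g : ℕ) * p.1.2 = n := by
  have hg := Nat.gcd_pos_of_pos_left n hm
  refine ⟨⟨m.gcd n, hg⟩,
    ⟨(⟨m / m.gcd n, Nat.div_pos (Nat.le_of_dvd hm (Nat.gcd_dvd_left m n)) hg⟩,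
      ⟨n / m.gcd n, Nat.div_pos (Nat.le_of_dvd hn (Nat.gcd_dvd_right m n)) hg⟩),
      Nat.coprime_div_gcd_div_gcd hg⟩, ?_, ?_⟩
  · exact Nat.mul_div_cancel' (Nat.gcd_dvd_left m n)
  · exact Nat.mul_div_cancel' (Nat.gcd_dvd_right m n)

theorem summable_coprimePair_cpow {u v : ℂ} (hu : 1 < u.re) (hv : 1 < v.re) :
    Summable fun p : CoprimePair => ((p.1.1 : ℕ) : ℂ) ^ (-u) * ((p.1.2 : ℕ) : ℂ) ^ (-v) :=
  ((hasSum_pnat_cpow_neg hu).mul_complex (hasSum_pnat_cpow_neg hv)).summable.subtype _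

theorem riemannZeta_mul_riemannZeta_eq {u v : ℂ} (hu : 1 < u.re) (hv : 1 < v.re) :
    riemannZeta u * riemannZeta v = riemannZeta (u + v) *
      ∑' p : CoprimePair, ((p.1.1 : ℕ) : ℂ) ^ (-u) * ((p.1.2 : ℕ) : ℂ) ^ (-v) := by
  have huv : 1 < (u + v).re := by rw [Complex.add_re]; linarith
  refine ((hasSum_pnat_cpow_neg hu).mul_complex (hasSum_pnat_cpow_neg hv)).unique ?_
  have hbij : Function.Bijective fun q : ℕ+ × CoprimePair =>
      (q.1 * q.2.1.1, q.1 * q.2.1.2) := by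
    refine ⟨fun x y h => CoprimePair.mul_injective ?_, fun ⟨m, n⟩ => ?_⟩
    · simp only [Prod.mk.injEq] at h
      simp only [h.1, h.2]
    · obtain ⟨g, p, h1, h2⟩ := CoprimePair.exists_mul_eq m.pos n.pos
      exact ⟨(g, p), Prod.ext (PNat.eq h1) (PNat.eq h2)⟩
  rw [← (Equiv.ofBijective _ hbij).hasSum_iff]
  convert (hasSum_pnat_cpow_neg huv).mul_complex (summable_coprimePair_cpow hu hv).hasSum
    using 2 with q
  have hg : ((q.1 : ℕ) : ℂ) ≠ 0 := by simp
  simp only [Function.comp_apply, Equiv.ofBijective_apply, PNat.mul_coe, Nat.cast_mul,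
    Complex.natCast_mul_natCast_cpow, neg_add, Complex.cpow_add _ _ hg]
  ring

theorem hasSum_sigmaC_mul_sigmaC {a b s : ℂ} (hs : 1 < s.re) (hsa : 1 < (s - a).re)
    (hsb : 1 < (s - b).re) (hsab : 1 < (s - a - b).re) :
    HasSum (fun m : ℕ+ => sigmaC a (m : ℕ) * sigmaC b (m : ℕ) / ((m : ℕ) : ℂ) ^ s)
      (riemannZeta s * (riemannZeta (s - a - b) *
        ∑' p : CoprimePair,
          ((p.1.1 : ℕ) : ℂ) ^ (-(s - a)) * ((p.1.2 : ℕ) : ℂ) ^ (-(s - b)))) := by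
  let F : ℕ × ℕ × ℕ → ℂ := fun t =>
    if t.2 ∈ t.1.divisors ×ˢ t.1.divisors then
      (t.2.1 : ℂ) ^ a * (t.2.2 : ℂ) ^ b / (t.1 : ℂ) ^ s else 0
  let φ : ℕ+ × ℕ+ × CoprimePair → ℕ × ℕ × ℕ := fun q =>
    (((q.2.1 * q.2.2.1.1 * q.2.2.1.2 * q.1 : ℕ+) : ℕ),
      ((q.2.1 * q.2.2.1.1 : ℕ+) : ℕ), ((q.2.1 * q.2.2.1.2 : ℕ+) : ℕ))
  have hinj : Function.Injective φ := by
    rintro ⟨k, q⟩ ⟨k', q'⟩ h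
    obtain ⟨h1, h2⟩ := Prod.mk.inj h
    obtain rfl := CoprimePair.mul_injective h2
    simp only [PNat.coe_inj, mul_right_inj] at h1
    rw [h1]
  have hrange : ∀ t ∉ Set.range φ, F t = 0 := by
    rintro ⟨m, D, E⟩ ht
    refine if_neg fun hmem => ht ?_
    simp only [Finset.mem_product, Nat.mem_divisors] at hmem
    obtain ⟨⟨hD, hm⟩, hE, -⟩ := hmem
    obtain ⟨g, p, rfl, rfl⟩ := CoprimePair.exists_mul_eq
      (Nat.pos_of_dvd_of_pos hD (Nat.pos_of_ne_zero hm))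
      (Nat.pos_of_dvd_of_pos hE (Nat.pos_of_ne_zero hm))
    have hl := Nat.lcm_dvd hD hE
    rw [Nat.lcm_mul_left, p.2.lcm_eq_mul] at hl
    obtain ⟨k, rfl⟩ := hl
    refine ⟨(⟨k, Nat.pos_of_ne_zero (right_ne_zero_of_mul hm)⟩, g, p), ?_⟩
    simp [φ, mul_assoc]
  have hF : HasSum F _ := (hinj.hasSum_iff hrange).mp <| by
    convert (hasSum_pnat_cpow_neg hs).mul_complex ((hasSum_pnat_cpow_neg hsab).mul_complex
      (summable_coprimePair_cpow hsa hsb).hasSum) using 2 with q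
    obtain ⟨k, g, ⟨⟨d, e⟩, h⟩⟩ := q
    have hmem : (φ (k, g, ⟨⟨d, e⟩, h⟩)).2 ∈ (φ (k, g, ⟨⟨d, e⟩, h⟩)).1.divisors ×ˢ
        (φ (k, g, ⟨⟨d, e⟩, h⟩)).1.divisors := by
      simp only [φ, Finset.mem_product, Nat.mem_divisors]
      refine ⟨⟨⟨e * k, ?_⟩, PNat.ne_zero _⟩, ⟨d * k, ?_⟩, PNat.ne_zero _⟩ <;>
        push_cast <;> ring
    have hg : ((g : ℕ) : ℂ) ≠ 0 := by simp
    have hd : ((d : ℕ) : ℂ) ≠ 0 := by simp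
    have he : ((e : ℕ) : ℂ) ≠ 0 := by simp
    simp only [Function.comp_apply, F, if_pos hmem]
    have hpow (x y : ℕ) (w : ℂ) : ((x * y : ℕ) : ℂ) ^ w = (x : ℂ) ^ w * (y : ℂ) ^ w := by
      rw [Nat.cast_mul, Complex.natCast_mul_natCast_cpow]
    rw [show -(s - a - b) = a + b + -s by ring, show -(s - a) = a + -s by ring,
      show -(s - b) = b + -s by ring, div_eq_mul_inv, ← Complex.cpow_neg]
    simp only [φ, PNat.mul_coe, hpow, Complex.cpow_add _ _ hg, Complex.cpow_add _ _ hd,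
      Complex.cpow_add _ _ he]
    ring
  have hfiber (m : ℕ) :
      HasSum (fun p => F (m, p)) (sigmaC a m * sigmaC b m / (m : ℂ) ^ s) := by
    have h : HasSum (fun p => F (m, p)) (∑ p ∈ m.divisors ×ˢ m.divisors, F (m, p)) :=
      hasSum_sum_of_ne_finset_zero fun p hp => if_neg hp
    convert h using 1
    rw [Finset.sum_congr rfl fun p hp => if_pos hp, sigmaC, sigmaC, Finset.sum_mul_sum,
      ← Finset.sum_product', Finset.sum_div]
  have hfib := hF.prod_fiberwise hfiber
  refine (PNat.coe_injective.hasSum_iff fun n hn => ?_).mpr hfib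
  obtain rfl : n = 0 := by
    by_contra h0
    exact hn ⟨⟨n, Nat.pos_of_ne_zero h0⟩, rfl⟩
  simp [sigmaC]

/-- Ramanujan's identity
`∑_{m≥1} σ_a(m) σ_b(m) / m^s = ζ(s)ζ(s−a)ζ(s−b)ζ(s−a−b)/ζ(2s−a−b)`. -/
theorem ramanujan_identity (a b s : ℂ) (hs : 1 < s.re) (hsa : 1 < (s - a).re)
    (hsb : 1 < (s - b).re) (hsab : 1 < (s - a - b).re) :
    Summable (fun m : ℕ+ => sigmaC a (m : ℕ) * sigmaC b (m : ℕ) / ((m : ℕ) : ℂ) ^ s) ∧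
    ∑' m : ℕ+, sigmaC a (m : ℕ) * sigmaC b (m : ℕ) / ((m : ℕ) : ℂ) ^ s
      = riemannZeta s * riemannZeta (s - a) * riemannZeta (s - b) *
          riemannZeta (s - a - b) / riemannZeta (2 * s - a - b) := by
  have hre : 1 < (2 * s - a - b).re := by
    simp only [Complex.sub_re, Complex.mul_re, Complex.re_ofNat, Complex.im_ofNat] at *
    linarith
  have h := hasSum_sigmaC_mul_sigmaC hs hsa hsb hsab
  refine ⟨h.summable, h.tsum_eq.trans ?_⟩
  have hz := riemannZeta_ne_zero_of_one_lt_re hre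
  have key := riemannZeta_mul_riemannZeta_eq hsa hsb
  rw [show s - a + (s - b) = 2 * s - a - b by ring] at key
  rw [eq_div_iff hz]
  linear_combination (-riemannZeta s * riemannZeta (s - a - b)) * key
end
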